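/- arXiv:2004.07452 — 5 statements merged into one kernel-verified Lean document; each statement's English description precedes it below -/
import Mathlib

section
/- Let G = C_{2n}(s₁,…,s_k, n) be a connected circulant graph of odd valency 2k+1 with 1 ≤ s₁ < … < s_k < n, and G̃ the cone over G. Then Jac(G̃) ≅ coker(𝒜ⁿ − (2k+2)I + Σ_{j=1}^{k}(𝒜^{s_j} + 𝒜^{−s_j})), where 𝒜 is the companion matrix of the Laurent polynomial (2k+2 − Σ_{j=1}^{k}(z^{s_j} + z^{−s_j}))² − 1. -/
open SimpleGraph

/-- The cone over a graph `G`. -/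
def cone {V : Type*} (G : SimpleGraph V) : SimpleGraph (Option V) :=
  SimpleGraph.fromRel (fun x y => x = none ∨ ∃ a b, x = some a ∧ y = some b ∧ G.Adj a b)

open scoped Classical in
/-- The Laplacian matrix of `G` with integer entries. -/
noncomputable def lap {V : Type*} [Fintype V] (G : SimpleGraph V) : Matrix V V ℤ :=
  G.lapMatrix ℤ

open scoped Classical in
/-- The cokernel `ℤ^α / im M` of an integer matrix `M`. -/
noncomputable abbrev coker {α : Type*} [Fintype α] (M : Matrix α α ℤ) :=
  (α → ℤ) ⧸ LinearMap.range (Matrix.toLin' M)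

open scoped Classical in
/-- The Jacobian (critical group) of a graph. -/
noncomputable def jac {V : Type*} [Fintype V] (G : SimpleGraph V) :=
  Submodule.torsion ℤ (coker (lap G))

/-- The companion matrix of the bimonic integer Laurent polynomial
`P(z) = z^p (c 0 + c 1 · z + ⋯ + c s · z^s)` (with `c 0 = c s = 1`). -/
def compMat (s : ℕ) (c : ℕ → ℤ) : Matrix (Fin s) (Fin s) ℤ :=
  Matrix.of fun i j =>
    if (i : ℕ) + 1 = s then -c j else if (j : ℕ) = (i : ℕ) + 1 then 1 else 0


open Matrix LaurentPolynomial in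
/-- evaluation of Laurent polynomials at an invertible matrix -/
noncomputable def evL {α : Type*} [Fintype α] [DecidableEq α] (U : (Matrix α α ℤ)ˣ) :
    LaurentPolynomial ℤ →ₐ[ℤ] Matrix α α ℤ :=
  AddMonoidAlgebra.lift ℤ (Matrix α α ℤ) ℤ ((Units.coeHom _).comp (zpowersHom _ U))

open LaurentPolynomial in
theorem evL_T {α : Type*} [Fintype α] [DecidableEq α] (U : (Matrix α α ℤ)ˣ) (i : ℤ) :
    evL U (T i) = ((U ^ i : (Matrix α α ℤ)ˣ) : Matrix α α ℤ) := by
  rw [evL, T, AddMonoidAlgebra.lift_single]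
  simp

open LaurentPolynomial Matrix in
theorem coker_equiv {α : Type*} [Fintype α] [DecidableEq α] (U : (Matrix α α ℤ)ˣ) (v : α → ℤ)
    (hv : ∀ x, ∃ f, evL U f *ᵥ v = x) (K : Ideal (LaurentPolynomial ℤ))
    (hK : ∀ f, evL U f *ᵥ v = 0 ↔ f ∈ K) (b : LaurentPolynomial ℤ) :
    Nonempty ((LaurentPolynomial ℤ ⧸ (K ⊔ Ideal.span {b})) ≃+ coker (evL U b)) := by
  let φ : LaurentPolynomial ℤ →+ (α → ℤ) :=
    { toFun := fun f => evL U f *ᵥ v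
      map_zero' := by simp
      map_add' := by intro x y; simp [Matrix.add_mulVec] }
  let ψ : LaurentPolynomial ℤ →+ coker (evL U b) :=
    (Submodule.mkQ (LinearMap.range (Matrix.toLin' (evL U b)))).toAddMonoidHom.comp φ
  have hψ : Function.Surjective ψ := by
    intro x
    obtain ⟨y, rfl⟩ := Submodule.mkQ_surjective _ x
    obtain ⟨f, rfl⟩ := hv y
    exact ⟨f, rfl⟩
  have hker : ψ.ker = (K ⊔ Ideal.span {b} : Ideal (LaurentPolynomial ℤ)).toAddSubgroup := by
    ext f
    rw [AddMonoidHom.mem_ker, Submodule.mem_toAddSubgroup]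
    change Submodule.mkQ (LinearMap.range (Matrix.toLin' (evL U b))) (evL U f *ᵥ v) = 0 ↔ _
    rw [Submodule.mkQ_apply, Submodule.Quotient.mk_eq_zero, LinearMap.mem_range,
      Submodule.mem_sup]
    constructor
    · rintro ⟨y, hy⟩
      obtain ⟨g, rfl⟩ := hv y
      rw [Matrix.toLin'_apply, Matrix.mulVec_mulVec, ← map_mul] at hy
      refine ⟨f - b * g, ?_, b * g, ?_, by ring⟩
      · rw [← hK, map_sub, Matrix.sub_mulVec, hy, sub_self]
      · exact Ideal.mul_mem_right _ _ (Ideal.mem_span_singleton_self b)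
    · rintro ⟨y, hy, z, hz, rfl⟩
      obtain ⟨g, rfl⟩ := Ideal.mem_span_singleton.1 hz
      refine ⟨evL U g *ᵥ v, ?_⟩
      rw [Matrix.toLin'_apply, Matrix.mulVec_mulVec, ← map_mul, map_add, Matrix.add_mulVec,
        (hK y).2 hy, zero_add]
  exact ⟨(QuotientAddGroup.quotientAddEquivOfEq hker.symm).trans
    (QuotientAddGroup.quotientKerEquivOfSurjective ψ hψ)⟩

open LaurentPolynomial in
theorem span_T (N : ℕ) (c : ℕ → ℤ) (hN : 0 < N) (h0 : IsUnit (c 0)) (hc : IsUnit (c N))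
    (K : Ideal (LaurentPolynomial ℤ))
    (hK : ∑ j ∈ Finset.range (N + 1), c j • (T (j : ℤ) : LaurentPolynomial ℤ) ∈ K)
    (f : LaurentPolynomial ℤ) :
    ∃ a : Fin N → ℤ, f - ∑ i, a i • (T ((i : ℕ) : ℤ) : LaurentPolynomial ℤ) ∈ K := by
  let W : Submodule ℤ (LaurentPolynomial ℤ) :=
    Submodule.span ℤ (Set.range fun i : Fin N => (T ((i : ℕ) : ℤ) : LaurentPolynomial ℤ)) ⊔
      K.restrictScalars ℤ
  have hKW : ∀ x ∈ K, x ∈ W := fun x hx => Submodule.mem_sup_right hx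
  have hTW : ∀ i : ℕ, i < N → T (i : ℤ) ∈ W := fun i hi =>
    Submodule.mem_sup_left (Submodule.subset_span ⟨⟨i, hi⟩, rfl⟩)
  have hun : ∀ (u : ℤ), IsUnit u → ∀ x, u • x ∈ W → x ∈ W := by
    intro u hu x hx
    rcases Int.isUnit_iff.1 hu with rfl | rfl
    · simpa using hx
    · simpa using hx
  have hN' : T (N : ℤ) ∈ W := by
    apply hun _ hc
    have := hKW _ hK
    rw [Finset.sum_range_succ] at this
    refine (W.add_mem_iff_right ?_).1 this
    refine W.sum_mem fun i hi => W.smul_mem _ (hTW i (Finset.mem_range.1 hi))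
  have hm1 : T (-1 : ℤ) ∈ W := by
    apply hun _ h0
    have := hKW _ (K.mul_mem_left (T (-1)) hK)
    rw [Finset.sum_range_succ', mul_add] at this
    have e : (T (-1) : LaurentPolynomial ℤ) * c 0 • T ((0 : ℕ) : ℤ) = c 0 • T (-1) := by
      simp
    rw [e] at this
    refine (W.add_mem_iff_right ?_).1 this
    rw [Finset.mul_sum]
    refine W.sum_mem fun i hi => ?_
    rw [mul_smul_comm, ← T_add]
    refine W.smul_mem _ ?_
    have := hTW i (Finset.mem_range.1 hi)
    convert this using 2
    push_cast; ring
  have hmul : ∀ x ∈ W, T 1 * x ∈ W ∧ T (-1) * x ∈ W := by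
    intro x hx
    obtain ⟨y, hy, z, hz, rfl⟩ := Submodule.mem_sup.1 hx
    have hz' : z ∈ K := hz
    clear hx
    have : T 1 * y ∈ W ∧ T (-1) * y ∈ W := by
      induction hy using Submodule.span_induction with
      | mem x h =>
        obtain ⟨i, rfl⟩ := h
        simp only [← T_add]
        constructor
        · rcases Nat.lt_or_ge (i + 1) N with h | h
          · have := hTW _ h
            rwa [Nat.cast_add, add_comm] at this
          · have : (i : ℕ) + 1 = N := by omega
            rw [← this, Nat.cast_add, add_comm] at hN'
            exact hN'
        · rcases Nat.eq_zero_or_pos (i : ℕ) with h | h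
          · rw [h]; simpa using hm1
          · have := hTW ((i : ℕ) - 1) (by omega)
            rw [Nat.cast_sub h] at this
            convert this using 2
            push_cast; ring
      | zero => simp
      | add x y hx hy h1 h2 =>
        exact ⟨by rw [mul_add]; exact W.add_mem h1.1 h2.1,
          by rw [mul_add]; exact W.add_mem h1.2 h2.2⟩
      | smul a x hx h1 =>
        exact ⟨by rw [mul_smul_comm]; exact W.smul_mem _ h1.1,
          by rw [mul_smul_comm]; exact W.smul_mem _ h1.2⟩
    exact ⟨by rw [mul_add]; exact W.add_mem this.1 (hKW _ (K.mul_mem_left _ hz')),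
      by rw [mul_add]; exact W.add_mem this.2 (hKW _ (K.mul_mem_left _ hz'))⟩
  have hall : ∀ i : ℤ, T i ∈ W := by
    intro i
    induction i using Int.induction_on with
    | zero => exact hTW 0 hN
    | succ i hi => have := (hmul _ hi).1; rwa [← T_add, add_comm] at this
    | pred i hi =>
      have := (hmul _ hi).2; rw [← T_add] at this
      convert this using 2; ring
  have hf : f ∈ W := by
    induction f using LaurentPolynomial.induction_on' with
    | add p q hp hq => exact W.add_mem hp hq
    | C_mul_T i a => rw [← smul_eq_C_mul]; exact W.smul_mem _ (hall i)
  obtain ⟨y, hy, z, hz, rfl⟩ := Submodule.mem_sup.1 hf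
  obtain ⟨a, rfl⟩ := (Submodule.mem_span_range_iff_exists_fun ℤ).1 hy
  exact ⟨a, by simpa using hz⟩

open LaurentPolynomial Matrix in
theorem ker_char {α : Type*} [Fintype α] [DecidableEq α] (U : (Matrix α α ℤ)ˣ) (v : α → ℤ)
    (hv : ∀ x, ∃ f, evL U f *ᵥ v = x)
    (N : ℕ) (hα : Fintype.card α = N) (c : ℕ → ℤ) (hN : 0 < N) (h0 : IsUnit (c 0))
    (hc : IsUnit (c N)) (P : LaurentPolynomial ℤ) 
    (hP : ∑ j ∈ Finset.range (N + 1), c j • (T (j : ℤ) : LaurentPolynomial ℤ) ∈ Ideal.span {P})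
    (hPv : evL U P *ᵥ v = 0)
    (f : LaurentPolynomial ℤ) : evL U f *ᵥ v = 0 ↔ f ∈ Ideal.span {P} := by
  have hsub : ∀ f ∈ Ideal.span {P}, evL U f *ᵥ v = 0 := by
    intro f hf
    obtain ⟨g, rfl⟩ := Ideal.mem_span_singleton.1 hf
    rw [mul_comm, map_mul, ← Matrix.mulVec_mulVec, hPv, Matrix.mulVec_zero]
  refine ⟨fun hf => ?_, hsub f⟩
  let g : (α → ℤ) ≃ₗ[ℤ] (Fin N → ℤ) := LinearEquiv.funCongrLeft ℤ ℤ
    ((Fintype.equivFinOfCardEq hα).symm)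
  let θ : (Fin N → ℤ) →ₗ[ℤ] (α → ℤ) :=
    Fintype.linearCombination ℤ (fun i : Fin N => evL U (T ((i : ℕ) : ℤ)) *ᵥ v)
  have hθ : ∀ a, θ a = evL U (∑ i, a i • (T ((i : ℕ) : ℤ) : LaurentPolynomial ℤ)) *ᵥ v := by
    intro a
    rw [Fintype.linearCombination_apply, map_sum, Matrix.sum_mulVec]
    refine Finset.sum_congr rfl fun i _ => ?_
    rw [map_smul, Matrix.smul_mulVec]
  have hred : ∀ f, ∃ a : Fin N → ℤ, f - ∑ i, a i • (T ((i : ℕ) : ℤ) : LaurentPolynomial ℤ) ∈ Ideal.span {P}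
      ∧ θ a = evL U f *ᵥ v := by
    intro f
    obtain ⟨a, ha⟩ := span_T N c hN h0 hc _ hP f
    refine ⟨a, ha, ?_⟩
    have := hsub _ ha
    rw [map_sub, Matrix.sub_mulVec, sub_eq_zero] at this
    rw [hθ, this]
  have hsurj : Function.Surjective (g.toLinearMap ∘ₗ θ) := by
    rw [LinearMap.coe_comp]
    refine g.surjective.comp ?_
    intro x
    obtain ⟨f, rfl⟩ := hv x
    obtain ⟨a, _, ha⟩ := hred f
    exact ⟨a, ha⟩
  have hinj := OrzechProperty.injective_of_surjective_endomorphism _ hsurj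
  obtain ⟨a, ha, ha'⟩ := hred f
  rw [hf] at ha'
  have : a = 0 := hinj (by simp [ha'])
  subst this
  simpa using ha

open Matrix in
theorem jac_equiv {V : Type*} [Fintype V] [DecidableEq V] (D : Matrix (Option V) (Option V) ℤ)
    (hrow : ∀ a, ∑ b, D a b = 0) (hcol : ∀ b, ∑ a, D a b = 0)
    (B : Matrix V V ℤ) (hB : ∀ a b, B a b = D (some a) (some b)) (hdet : B.det ≠ 0) :
    Nonempty (coker B ≃+ Submodule.torsion ℤ (coker D)) := by
  let ext : (V → ℤ) →ₗ[ℤ] (Option V → ℤ) :=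
    { toFun := fun v o => o.elim (-∑ a, v a) v
      map_add' := by
        intro x y; ext o; cases o <;> simp [Finset.sum_add_distrib]; ring
      map_smul' := by
        intro r x; ext o; cases o <;> simp [Finset.mul_sum] }
  have ext_some : ∀ v a, ext v (some a) = v a := fun _ _ => rfl
  have ext_none : ∀ v, ext v none = -∑ a, v a := fun _ => rfl
  have sumD : ∀ u : Option V → ℤ, ∑ o, (D *ᵥ u) o = 0 := by
    intro u
    simp only [mulVec, dotProduct]
    rw [Finset.sum_comm]
    refine Finset.sum_eq_zero fun b _ => ?_
    rw [← Finset.sum_mul, hcol, zero_mul]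
  have ext_of : ∀ w : Option V → ℤ, ∑ o, w o = 0 → ext (fun a => w (some a)) = w := by
    intro w hw
    ext o
    cases o with
    | none => rw [ext_none]; rw [Fintype.sum_option] at hw; linarith
    | some a => rfl
  have hext : ∀ u : V → ℤ, ext (B *ᵥ u) = D *ᵥ (fun o => o.elim 0 u) := by
    intro u
    rw [← ext_of (D *ᵥ (fun o => o.elim 0 u)) (sumD _)]
    congr 1
    ext a
    simp [mulVec, dotProduct, Fintype.sum_option, hB]
  let ψ : (V → ℤ) →ₗ[ℤ] coker D :=
    (Submodule.mkQ (LinearMap.range (Matrix.toLin' D))) ∘ₗ ext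
  have hψ : ∀ v, ψ v = 0 ↔ ∃ u, D *ᵥ u = ext v := by
    intro v
    change Submodule.mkQ (LinearMap.range (Matrix.toLin' D)) (ext v) = 0 ↔ _
    rw [Submodule.mkQ_apply, Submodule.Quotient.mk_eq_zero, LinearMap.mem_range]
    rfl
  have hker : LinearMap.ker ψ = LinearMap.range (Matrix.toLin' B) := by
    ext v
    rw [LinearMap.mem_ker, hψ, LinearMap.mem_range]
    constructor
    · rintro ⟨u, hu⟩
      refine ⟨fun a => u (some a) - u none, ?_⟩
      rw [Matrix.toLin'_apply]
      ext a
      have h1 := congrFun hu (some a)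
      have h2 := hrow (some a)
      rw [ext_some] at h1
      rw [← h1]
      rw [Fintype.sum_option] at h2
      simp only [mulVec, dotProduct, Fintype.sum_option, hB, mul_sub, Finset.sum_sub_distrib,
        ← Finset.sum_mul]
      linear_combination (-u none) * h2
    · rintro ⟨u, rfl⟩
      rw [Matrix.toLin'_apply]
      exact ⟨_, (hext u).symm⟩
  have hrange : LinearMap.range ψ = Submodule.torsion ℤ (coker D) := by
    ext x
    rw [LinearMap.mem_range, Submodule.mem_torsion_iff]
    constructor
    · rintro ⟨v, rfl⟩
      refine ⟨⟨B.det, mem_nonZeroDivisors_of_ne_zero hdet⟩, ?_⟩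
      change B.det • ψ v = 0
      rw [← map_smul, ← LinearMap.mem_ker, hker, LinearMap.mem_range]
      refine ⟨B.adjugate *ᵥ v, ?_⟩
      rw [Matrix.toLin'_apply, Matrix.mulVec_mulVec, Matrix.mul_adjugate, Matrix.smul_mulVec,
        Matrix.one_mulVec]
    · rintro ⟨⟨d, hd⟩, hx⟩
      obtain ⟨w, rfl⟩ := Submodule.mkQ_surjective _ x
      change d • (Submodule.mkQ (LinearMap.range (Matrix.toLin' D)) w) = 0 at hx
      rw [← map_smul, Submodule.mkQ_apply, Submodule.Quotient.mk_eq_zero,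
        LinearMap.mem_range] at hx
      obtain ⟨u, hu⟩ := hx
      rw [Matrix.toLin'_apply] at hu
      have hs := sumD u
      rw [hu] at hs
      simp only [Pi.smul_apply, smul_eq_mul, ← Finset.mul_sum] at hs
      have hw := (mul_eq_zero.1 hs).resolve_left (nonZeroDivisors.ne_zero hd)
      refine ⟨fun a => w (some a), ?_⟩
      change Submodule.mkQ (LinearMap.range (Matrix.toLin' D)) (ext _) = _
      rw [ext_of w hw]
      rfl
  exact ⟨((Submodule.quotEquivOfEq _ _ hker.symm).trans
    (ψ.quotKerEquivRange.trans (LinearEquiv.ofEq _ _ hrange))).toAddEquiv⟩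

theorem cone_adj_some {V : Type*} (G : SimpleGraph V) (a b : V) :
    (cone G).Adj (some a) (some b) ↔ G.Adj a b := by
  simp only [cone, SimpleGraph.fromRel_adj]
  constructor
  · rintro ⟨_, (h | ⟨x, y, hx, hy, h⟩) | (h | ⟨x, y, hx, hy, h⟩)⟩
    · simp at h
    · simp at hx hy; subst hx hy; exact h
    · simp at h
    · simp at hx hy; subst hx hy; exact h.symm
  · intro h
    exact ⟨by simpa using h.ne, Or.inl (Or.inr ⟨a, b, rfl, rfl, h⟩)⟩

theorem cone_adj_none {V : Type*} (G : SimpleGraph V) (a : V) :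
    (cone G).Adj (some a) none := by
  simp [cone, SimpleGraph.fromRel_adj]

open Matrix in
theorem jac_cone {V : Type*} [Fintype V] [DecidableEq V] (G : SimpleGraph V)
    (J : V → V → ℤ) (r : ℤ) (hr : ∀ a, ∑ b, J a b = r)
    (h0 : ∀ a b, G.Adj a b → J a b = 1) (h1 : ∀ a b, ¬ G.Adj a b → J a b = 0)
    (B : Matrix V V ℤ) (hB : ∀ a b, B a b = (if a = b then r + 1 else 0) - J a b) :
    Nonempty (coker B ≃+ jac (cone G)) := by
  classical
  have hJ : ∀ a b, J a b = if G.Adj a b then 1 else 0 := by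
    intro a b; split_ifs with h
    · exact h0 a b h
    · exact h1 a b h
  have hrow : ∀ a, ∑ b, lap (cone G) a b = 0 := by
    intro a
    have := congrFun (SimpleGraph.lapMatrix_mulVec_const_eq_zero (R := ℤ) (cone G)) a
    simp only [mulVec, dotProduct, mul_one, Pi.zero_apply] at this
    rw [← this]
    unfold lap
    refine Finset.sum_congr rfl fun b _ => ?_
    congr!
  have hsymm : ∀ a b, lap (cone G) a b = lap (cone G) b a := by
    intro a b
    unfold lap
    have h := (SimpleGraph.isSymm_lapMatrix ℤ (cone G)).apply b a
    convert h
  have hne : ∀ a b, a ≠ b → lap (cone G) a b = if (cone G).Adj a b then -1 else 0 := by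
    intro a b hab
    unfold lap
    simp [SimpleGraph.lapMatrix, SimpleGraph.degMatrix, hab, SimpleGraph.adjMatrix_apply]
    split_ifs <;> simp
  have hBlap : ∀ a b, B a b = lap (cone G) (some a) (some b) := by
    intro a b
    by_cases hab : a = b
    · subst hab
      have h := hrow (some a)
      rw [Fintype.sum_option, hne _ _ (by simp), if_pos (cone_adj_none G a),
        ← Finset.add_sum_erase _ _ (Finset.mem_univ a)] at h
      have h2 : ∑ b ∈ Finset.univ.erase a, lap (cone G) (some a) (some b) =
          -∑ b ∈ Finset.univ.erase a, J a b := by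
        rw [← Finset.sum_neg_distrib]
        refine Finset.sum_congr rfl fun b hb => ?_
        rw [hne _ _ (by simpa using (Finset.ne_of_mem_erase hb).symm), hJ]
        simp only [cone_adj_some]
        split_ifs <;> simp
      have h3 := hr a
      rw [← Finset.add_sum_erase _ _ (Finset.mem_univ a), hJ a a, if_neg (G.irrefl)] at h3
      rw [hB, if_pos rfl, hJ a a, if_neg (G.irrefl)]
      linarith
    · rw [hB, if_neg hab, hne _ _ (by simpa using hab), hJ]
      simp only [cone_adj_some]
      split_ifs <;> simp
  have hdet : B.det ≠ 0 := by
    have : (B.map (Int.castRingHom ℝ)).det ≠ 0 := by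
      apply det_ne_zero_of_sum_row_lt_diag
      intro a
      have h3 := hr a
      rw [← Finset.add_sum_erase _ _ (Finset.mem_univ a), hJ a a, if_neg (G.irrefl), zero_add] at h3
      have h4 : ∑ j ∈ Finset.univ.erase a, ‖(B.map (Int.castRingHom ℝ)) a j‖ = (r : ℝ) := by
        rw [← h3, Int.cast_sum]
        refine Finset.sum_congr rfl fun b hb => ?_
        rw [Matrix.map_apply, hB, if_neg (Finset.ne_of_mem_erase hb).symm, hJ]
        split_ifs <;> simp
      rw [h4, Matrix.map_apply, hB, if_pos rfl, hJ a a, if_neg (G.irrefl)]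
      simp only [sub_zero, eq_intCast, Int.cast_add, Int.cast_one, Real.norm_eq_abs]
      exact lt_of_lt_of_le (lt_add_one _) (le_abs_self _)
    intro h
    apply this
    rw [← RingHom.mapMatrix_apply, ← RingHom.map_det, h, map_zero]
  exact jac_equiv (lap (cone G)) hrow (fun b => by simp_rw [hsymm _ b]; exact hrow b) B hBlap hdet

open Matrix in
theorem compMat_e (N : ℕ) (c : ℕ → ℤ) (j : ℕ) (hj : j + 1 < N) :
    compMat N c *ᵥ (fun i : Fin N => if (i : ℕ) = j + 1 then (1 : ℤ) else 0) =
      (fun i : Fin N => if (i : ℕ) = j then (1 : ℤ) else 0) -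
        c (j + 1) • (fun i : Fin N => if (i : ℕ) + 1 = N then (1 : ℤ) else 0) := by
  have h : (fun i : Fin N => if (i : ℕ) = j + 1 then (1 : ℤ) else 0) =
      Pi.single (⟨j + 1, hj⟩ : Fin N) 1 := by
    ext i; simp [Pi.single_apply, Fin.ext_iff]
  rw [h, Matrix.mulVec_single_one]
  ext i
  simp only [Matrix.col_apply, compMat, Matrix.of_apply, Pi.sub_apply, Pi.smul_apply, smul_eq_mul]
  split_ifs <;> first | omega | simp_all

open Matrix in
theorem compMat_e0 (N : ℕ) (c : ℕ → ℤ) (hN : 0 < N) :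
    compMat N c *ᵥ (fun i : Fin N => if (i : ℕ) = 0 then (1 : ℤ) else 0) =
       - c 0 • (fun i : Fin N => if (i : ℕ) + 1 = N then (1 : ℤ) else 0) := by
  have h : (fun i : Fin N => if (i : ℕ) = 0 then (1 : ℤ) else 0) =
      Pi.single (⟨0, hN⟩ : Fin N) 1 := by
    ext i; simp [Pi.single_apply, Fin.ext_iff]
  rw [h, Matrix.mulVec_single_one]
  ext i
  simp only [Matrix.col_apply, compMat, Matrix.of_apply, Pi.smul_apply, smul_eq_mul]
  split_ifs <;> first | omega | simp_all

theorem sum_e (N : ℕ) (x : Fin N → ℤ) :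
    x = ∑ j : Fin N, x j • (fun i : Fin N => if (i : ℕ) = (j : ℕ) then (1 : ℤ) else 0) := by
  ext i
  simp [Finset.sum_apply, ← Fin.ext_iff]

open Matrix in
theorem compMat_isUnit (N : ℕ) (c : ℕ → ℤ) (hN : 0 < N) (h0 : c 0 = 1) :
    IsUnit (compMat N c) := by
  rw [← Matrix.mulVec_surjective_iff_isUnit]
  let W := LinearMap.range (compMat N c).mulVecLin
  have hlast : (fun i : Fin N => if (i : ℕ) + 1 = N then (1 : ℤ) else 0) ∈ W := by
    refine ⟨-(fun i : Fin N => if (i : ℕ) = 0 then (1 : ℤ) else 0), ?_⟩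
    rw [Matrix.mulVecLin_apply, Matrix.mulVec_neg, compMat_e0 N c hN, h0]
    simp
  have hall : ∀ j, j < N → (fun i : Fin N => if (i : ℕ) = j then (1 : ℤ) else 0) ∈ W := by
    intro j hj
    rcases Nat.lt_or_ge (j + 1) N with h | h
    · have := compMat_e N c j h
      rw [eq_sub_iff_add_eq] at this
      rw [← this]
      exact W.add_mem ⟨_, rfl⟩ (W.smul_mem _ hlast)
    · have e : (fun i : Fin N => if (i : ℕ) = j then (1 : ℤ) else 0) =
          fun i : Fin N => if (i : ℕ) + 1 = N then (1 : ℤ) else 0 := by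
        ext i; congr 1; apply propext; omega
      rw [e]; exact hlast
  intro x
  have : x ∈ W := by
    rw [sum_e N x]
    exact W.sum_mem fun j _ => W.smul_mem _ (hall j j.2)
  exact this

open Matrix in
theorem compMat_horner (N : ℕ) (c : ℕ → ℤ) (hN : 0 < N) (hc : c N = 1) (t : ℕ) (ht : t < N) :
    (fun i : Fin N => if (i : ℕ) + 1 + t = N then (1 : ℤ) else 0) =
    (∑ i ∈ Finset.range (t + 1), c (N - t + i) • compMat N c ^ i) *ᵥ
      (fun i : Fin N => if (i : ℕ) + 1 = N then (1 : ℤ) else 0) := by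
  induction t with
  | zero => simp [hc]
  | succ t ih =>
    have ih := ih (by omega)
    rw [Finset.sum_range_succ']
    have e : ∑ i ∈ Finset.range (t + 1), c (N - (t + 1) + (i + 1)) • compMat N c ^ (i + 1) =
        compMat N c * ∑ i ∈ Finset.range (t + 1), c (N - t + i) • compMat N c ^ i := by
      rw [Finset.mul_sum]
      refine Finset.sum_congr rfl fun i _ => ?_
      rw [mul_smul_comm, pow_succ']
      congr 2
      omega
    rw [e, Matrix.add_mulVec, ← Matrix.mulVec_mulVec, ← ih]
    have h := compMat_e N c (N - (t + 1) - 1) (by omega)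
    have e1 : (fun i : Fin N => if (i : ℕ) + 1 + t = N then (1 : ℤ) else 0) =
      fun i : Fin N => if (i : ℕ) = N - (t + 1) - 1 + 1 then (1 : ℤ) else 0 := by
      ext i; congr 1; apply propext; omega
    rw [e1, h]
    have e2 : N - (t + 1) - 1 + 1 = N - (t + 1) + 0 := by omega
    rw [e2, pow_zero, Matrix.smul_mulVec, Matrix.one_mulVec, sub_add_cancel]
    ext i; congr 1; apply propext; omega

open Matrix in
theorem compMat_zero (N : ℕ) (c : ℕ → ℤ) (hN : 0 < N) (hc : c N = 1) :
    (∑ i ∈ Finset.range (N + 1), c i • compMat N c ^ i) *ᵥ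
      (fun i : Fin N => if (i : ℕ) + 1 = N then (1 : ℤ) else 0) = 0 := by
  have ih := compMat_horner N c hN hc (N - 1) (by omega)
  rw [Finset.sum_range_succ']
  have e : ∑ i ∈ Finset.range N, c (i + 1) • compMat N c ^ (i + 1) =
      compMat N c * ∑ i ∈ Finset.range (N - 1 + 1), c (N - (N - 1) + i) • compMat N c ^ i := by
    rw [Finset.mul_sum, Nat.sub_add_cancel hN]
    refine Finset.sum_congr rfl fun i _ => ?_
    rw [mul_smul_comm, pow_succ']
    congr 2
    omega
  rw [e, Matrix.add_mulVec, ← Matrix.mulVec_mulVec, ← ih]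
  have e1 : (fun i : Fin N => if (i : ℕ) + 1 + (N - 1) = N then (1 : ℤ) else 0) =
      fun i : Fin N => if (i : ℕ) = 0 then (1 : ℤ) else 0 := by
    ext i; congr 1; apply propext; omega
  rw [e1, compMat_e0 N c hN, pow_zero, Matrix.smul_mulVec, Matrix.one_mulVec]
  simp

open Matrix LaurentPolynomial in
theorem comp_side (N : ℕ) (c : ℕ → ℤ) (hN : 0 < N) (h0 : c 0 = 1) (hc : c N = 1)
    (U : (Matrix (Fin N) (Fin N) ℤ)ˣ) (hU : (U : Matrix (Fin N) (Fin N) ℤ) = compMat N c)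
    (P : LaurentPolynomial ℤ) (d : ℤ)
    (hP : P = T d * ∑ j ∈ Finset.range (N + 1), c j • (T (j : ℤ) : LaurentPolynomial ℤ))
    (b : LaurentPolynomial ℤ) :
    Nonempty ((LaurentPolynomial ℤ ⧸ (Ideal.span {P} ⊔ Ideal.span {b})) ≃+ coker (evL U b)) := by
  have hev : ∀ (r : ℕ) (f : ℕ → ℤ), evL U (∑ i ∈ Finset.range r, f i • T (i : ℤ)) =
      ∑ i ∈ Finset.range r, f i • compMat N c ^ i := by
    intro r f
    rw [map_sum]
    refine Finset.sum_congr rfl fun i _ => ?_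
    rw [map_smul, evL_T, zpow_natCast, Units.val_pow_eq_pow_val, hU]
  have hv : ∀ x, ∃ f, evL U f *ᵥ (fun i : Fin N => if (i : ℕ) + 1 = N then (1 : ℤ) else 0) = x := by
    intro x
    refine ⟨∑ j : Fin N, x j • ∑ i ∈ Finset.range (N - 1 - j + 1),
      c (N - (N - 1 - j) + i) • T (i : ℤ), ?_⟩
    conv_rhs => rw [sum_e N x]
    rw [map_sum, Matrix.sum_mulVec]
    refine Finset.sum_congr rfl fun j _ => ?_
    rw [map_smul, hev, Matrix.smul_mulVec, ← compMat_horner N c hN hc _ (by omega)]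
    congr 1
    ext i; congr 1; apply propext; omega
  refine coker_equiv U _ hv _ (ker_char U _ hv N (by simp) c hN (by simp [h0]) (by simp [hc]) P
    ?_ ?_) b
  · rw [Ideal.mem_span_singleton, hP]
    refine ⟨T (-d), ?_⟩
    rw [mul_comm, ← mul_assoc, ← T_add]
    simp
  · rw [hP, map_mul, ← Matrix.mulVec_mulVec, hev, compMat_zero N c hN hc, Matrix.mulVec_zero]

/-- The shift matrix. -/
def shiftMat (N : ℕ) (g : ZMod N) : Matrix (ZMod N) (ZMod N) ℤ :=
  Matrix.of fun a b => if a = b + g then 1 else 0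

theorem shiftMat_mul (N : ℕ) [NeZero N] (g h : ZMod N) :
    shiftMat N g * shiftMat N h = shiftMat N (g + h) := by
  ext a b
  simp only [shiftMat, Matrix.mul_apply, Matrix.of_apply, mul_ite, mul_one, mul_zero,
    Finset.sum_ite_eq', Finset.sum_ite_eq, Finset.mem_univ, if_true]
  congr 1
  rw [add_assoc, add_comm h g]

theorem shiftMat_zero (N : ℕ) [NeZero N] : shiftMat N 0 = 1 := by
  ext a b
  simp [shiftMat, Matrix.one_apply]

/-- The shift as a unit. -/
def shiftU (N : ℕ) [NeZero N] : (Matrix (ZMod N) (ZMod N) ℤ)ˣ :=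
  ⟨shiftMat N 1, shiftMat N (-1), by rw [shiftMat_mul, add_neg_cancel, shiftMat_zero],
    by rw [shiftMat_mul, neg_add_cancel, shiftMat_zero]⟩

theorem shiftU_zpow (N : ℕ) [NeZero N] (i : ℤ) :
    ((shiftU N ^ i : (Matrix (ZMod N) (ZMod N) ℤ)ˣ) : Matrix (ZMod N) (ZMod N) ℤ) =
      shiftMat N (i : ZMod N) := by
  induction i using Int.induction_on with
  | zero => simp [shiftMat_zero]
  | succ i hi =>
    rw [zpow_add_one, Units.val_mul, hi]
    change _ * shiftMat N 1 = _
    rw [shiftMat_mul]; push_cast; rfl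
  | pred i hi =>
    rw [zpow_sub_one, Units.val_mul, hi]
    change _ * shiftMat N (-1) = _
    rw [shiftMat_mul]; push_cast; rw [sub_eq_add_neg]

open Matrix LaurentPolynomial in
theorem shift_side (N : ℕ) [NeZero N] (b : LaurentPolynomial ℤ) :
    Nonempty ((LaurentPolynomial ℤ ⧸ (Ideal.span {(T (N : ℤ) - 1 : LaurentPolynomial ℤ)} ⊔
      Ideal.span {b})) ≃+ coker (evL (shiftU N) b)) := by
  have hN : 0 < N := Nat.pos_of_ne_zero (NeZero.ne N)
  have hv : ∀ x, ∃ f, evL (shiftU N) f *ᵥ (Pi.single 0 1 : ZMod N → ℤ) = x := by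
    intro x
    refine ⟨∑ a : ZMod N, x a • T (a.val : ℤ), ?_⟩
    rw [map_sum, Matrix.sum_mulVec]
    ext i
    simp only [map_smul, evL_T, shiftU_zpow, Matrix.smul_mulVec, Matrix.mulVec_single_one]
    simp [Finset.sum_apply, shiftMat]
  refine coker_equiv (shiftU N) _ hv _ (ker_char (shiftU N) _ hv N (by simp)
    (fun j => (if j = N then 1 else 0) - (if j = 0 then 1 else 0)) hN
    (by simp [hN.ne]) (by simp [hN.ne']) _ ?_ ?_) b
  · have : ∑ j ∈ Finset.range (N + 1), ((if j = N then (1 : ℤ) else 0) - (if j = 0 then 1 else 0)) •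
      (T (j : ℤ) : LaurentPolynomial ℤ) = T (N : ℤ) - 1 := by
      simp only [sub_smul, ite_smul, one_smul, zero_smul, Finset.sum_sub_distrib]
      simp
    rw [this]
    exact Ideal.mem_span_singleton_self _
  · rw [map_sub, evL_T, shiftU_zpow]
    rw [Int.cast_natCast, ZMod.natCast_self, shiftMat_zero, map_one, sub_self, Matrix.zero_mulVec]

/-- The Laurent polynomial `2k+2 - ∑ (z^s + z^{-s})`. -/
noncomputable def polQ (k : ℕ) (s : Fin k → ℕ) : LaurentPolynomial ℤ :=
  (2 * (k : ℤ) + 2) • 1 -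
    ∑ l : Fin k, (LaurentPolynomial.T (s l : ℤ) + LaurentPolynomial.T (-(s l : ℤ)))

open LaurentPolynomial in
theorem polQ_coeff (k : ℕ) (s : Fin k → ℕ) (x : ℤ) :
    (polQ k s).coeff x = (if x = 0 then (2 * (k : ℤ) + 2) else 0) -
      ∑ l : Fin k, ((if x = (s l : ℤ) then 1 else 0) + (if x = -(s l : ℤ) then 1 else 0)) := by
  rw [polQ, ← T_zero]
  simp only [AddMonoidAlgebra.coeff_sub, AddMonoidAlgebra.coeff_smul, AddMonoidAlgebra.coeff_sum,
    AddMonoidAlgebra.coeff_add, Finsupp.sub_apply, Finsupp.smul_apply, Finsupp.finsetSum_apply,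
    Finsupp.add_apply, T_apply, smul_eq_mul, mul_ite, mul_one, mul_zero, eq_comm (b := x)]

open LaurentPolynomial in
theorem coeff_sum_T {ι : Type*} (S : Finset ι) (f : ι → ℤ) (e : ι → ℤ) (x : ℤ) :
    (∑ i ∈ S, f i • (T (e i) : LaurentPolynomial ℤ)).coeff x =
      ∑ i ∈ S, if e i = x then f i else 0 := by
  simp only [AddMonoidAlgebra.coeff_smul, AddMonoidAlgebra.coeff_sum,
    Finsupp.smul_apply, Finsupp.finsetSum_apply,
    T_apply, smul_eq_mul, mul_ite, mul_one, mul_zero]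

open LaurentPolynomial in
theorem sq_expand (m : ℕ) (q : ℤ → ℤ) (Q : LaurentPolynomial ℤ) (hQ : ∀ x, Q.coeff x = q x)
    (hout : ∀ x, x < -(m : ℤ) ∨ (m : ℤ) < x → q x = 0) (c : ℕ → ℤ)
    (hc : c = fun (j : ℕ) => (∑ t ∈ Finset.Icc (-(m : ℤ)) (m : ℤ), q t * q ((j : ℤ) - 2 * m - t)) -
      (if (j : ℤ) = 2 * m then 1 else 0)) :
    Q * Q - 1 = T (-(2 * (m : ℤ))) *
      ∑ j ∈ Finset.range (4 * m + 1), c j • (T (j : ℤ) : LaurentPolynomial ℤ) := by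
  have hQs : Q = ∑ t ∈ Finset.Icc (-(m : ℤ)) (m : ℤ), q t • (T t : LaurentPolynomial ℤ) := by
    apply LaurentPolynomial.ext
    intro x
    rw [hQ, coeff_sum_T, Finset.sum_ite_eq']
    split_ifs with h
    · rfl
    · apply hout
      rw [Finset.mem_Icc] at h
      omega
  have hQQ : ∀ x, (Q * Q - 1).coeff x =
      (∑ t ∈ Finset.Icc (-(m : ℤ)) (m : ℤ), q t * q (x - t)) - (if x = 0 then 1 else 0) := by
    intro x
    rw [← T_zero, AddMonoidAlgebra.coeff_sub, Finsupp.sub_apply, T_apply]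
    congr 1
    · nth_rewrite 1 [hQs]
      rw [Finset.sum_mul, AddMonoidAlgebra.coeff_sum, Finsupp.finsetSum_apply]
      refine Finset.sum_congr rfl fun t _ => ?_
      rw [smul_mul_assoc, AddMonoidAlgebra.coeff_smul, Finsupp.smul_apply, T,
        AddMonoidAlgebra.coeff_single_mul_apply, one_mul, hQ, smul_eq_mul]
      congr 2
      ring
    · simp only [eq_comm (b := x)]
  apply LaurentPolynomial.ext
  intro x
  rw [hQQ, Finset.mul_sum]
  simp only [mul_smul_comm, ← T_add]
  rw [coeff_sum_T]
  by_cases hx : x < -(2 * (m : ℤ)) ∨ 2 * (m : ℤ) < x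
  · rw [if_neg (by omega), sub_zero, Finset.sum_eq_zero, Finset.sum_eq_zero]
    · intro j hj
      rw [Finset.mem_range] at hj
      rw [if_neg (by omega)]
    · intro t ht
      rw [Finset.mem_Icc] at ht
      rw [hout (x - t) (by omega), mul_zero]
  · rw [Finset.sum_eq_single (x + 2 * m).toNat]
    · have e : (((x + 2 * m).toNat : ℕ) : ℤ) = x + 2 * m := Int.toNat_of_nonneg (by omega)
      rw [if_pos (show -(2 * (m : ℤ)) + (((x + 2 * m).toNat : ℕ) : ℤ) = x by omega), hc]
      simp only [e]
      congr 1
      · refine Finset.sum_congr rfl fun t _ => ?_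
        congr 2; ring
      · congr 1; apply propext; omega
    · intro j _ hj
      rw [if_neg (by omega)]
    · intro h
      rw [Finset.mem_range] at h
      omega

theorem circ_J (n k : ℕ) (hn : 0 < n) [NeZero (2 * n)]
    (s : Fin k → ℕ) (hmono : StrictMono s) (h1 : ∀ l, 1 ≤ s l) (h2 : ∀ l, s l < n)
    (d : ZMod (2 * n)) :
    ((∃ l, d = s l ∨ d = -(s l : ZMod (2 * n))) ∨ d = n →
      (∑ l : Fin k, ((if d = (s l : ZMod (2 * n)) then (1 : ℤ) else 0) +
        (if d = -(s l : ZMod (2 * n)) then 1 else 0))) + (if d = n then 1 else 0) = 1) ∧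
    (¬ ((∃ l, d = s l ∨ d = -(s l : ZMod (2 * n))) ∨ d = n) →
      (∑ l : Fin k, ((if d = (s l : ZMod (2 * n)) then (1 : ℤ) else 0) +
        (if d = -(s l : ZMod (2 * n)) then 1 else 0))) + (if d = n then 1 else 0) = 0) := by
  have hnn : -(n : ZMod (2 * n)) = n := by
    rw [neg_eq_iff_add_eq_zero]
    have := ZMod.natCast_self (2 * n)
    push_cast at this
    rw [← this]; ring
  have F1 : ∀ l l', (s l : ZMod (2 * n)) = s l' ↔ l = l' := by
    intro l l'
    constructor
    · intro h
      rw [ZMod.natCast_eq_natCast_iff', Nat.mod_eq_of_lt (by have := h2 l; omega),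
        Nat.mod_eq_of_lt (by have := h2 l'; omega)] at h
      exact hmono.injective h
    · rintro rfl; rfl
  have F2 : ∀ l l', (s l : ZMod (2 * n)) ≠ -s l' := by
    intro l l' h
    rw [eq_neg_iff_add_eq_zero, ← Nat.cast_add, ZMod.natCast_eq_zero_iff] at h
    have := Nat.le_of_dvd (by have := h1 l; omega) h
    have := h2 l
    have := h2 l'
    omega
  have F3 : ∀ l, (s l : ZMod (2 * n)) ≠ n := by
    intro l h
    rw [ZMod.natCast_eq_natCast_iff', Nat.mod_eq_of_lt (by have := h2 l; omega),
        Nat.mod_eq_of_lt (by omega)] at h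
    have := h2 l
    omega
  have F4 : ∀ l, -(s l : ZMod (2 * n)) ≠ n := by
    intro l h
    rw [neg_eq_iff_eq_neg, hnn] at h
    exact F3 l h
  have F2' : ∀ l l', -(s l : ZMod (2 * n)) ≠ s l' := fun l l' h => F2 l' l h.symm
  constructor
  · rintro (⟨l, rfl | rfl⟩ | rfl)
    · simp [F1, F2, F3]
    · simp [F1, F2', F4]
    · have F3' : ∀ l, (n : ZMod (2 * n)) ≠ s l := fun l h => F3 l h.symm
      have F4' : ∀ l, (n : ZMod (2 * n)) ≠ -s l := fun l h => F4 l h.symm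
      simp [F3', F4']
  · intro h
    push Not at h
    simp [h.1, h.2]

/-- Jacobian of the cone over the odd-valency circulant graph `C_{2n}(s₁,…,s_k,n)`:
it is isomorphic to `coker (𝒜ⁿ - (2k+2)I + ∑ⱼ (𝒜^{sⱼ} + 𝒜^{-sⱼ}))`, where `𝒜` is the
companion matrix of the Laurent polynomial `(2k+2 - ∑ⱼ (z^{sⱼ} + z^{-sⱼ}))² - 1`
(of span `4 s_k`), whose coefficient sequences are written out explicitly below:
`q` is the coefficient function of `2k+2 - ∑ⱼ (z^{sⱼ} + z^{-sⱼ})`, and `c j` is the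
coefficient of `z^{j - 2 s_k}` in `(2k+2 - ∑ⱼ (z^{sⱼ} + z^{-sⱼ}))² - 1`. -/
theorem jac_cone_circulant_odd
    (n k : ℕ) (hn : 0 < n) [NeZero (2 * n)] (hk : 0 < k)
    (s : Fin k → ℕ) (hmono : StrictMono s) (h1 : ∀ l, 1 ≤ s l) (h2 : ∀ l, s l < n)
    (G : SimpleGraph (ZMod (2 * n)))
    (hGdef : G = circulantGraph
      (Set.range (fun l : Fin k => ((s l : ZMod (2 * n)))) ∪ {(n : ZMod (2 * n))}))
    (hconn : G.Connected)
    (m : ℕ) (hm : m = s ⟨k - 1, Nat.sub_lt hk one_pos⟩)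
    (q : ℤ → ℤ)
    (hq : q = fun t => (if t = 0 then (2 * (k : ℤ) + 2) else 0) -
      ∑ l : Fin k, ((if t = (s l : ℤ) then 1 else 0) + (if t = -(s l : ℤ) then 1 else 0)))
    (c : ℕ → ℤ)
    (hc : c = fun (j : ℕ) => (∑ t ∈ Finset.Icc (-(m : ℤ)) (m : ℤ), q t * q ((j : ℤ) - 2 * m - t)) -
      (if (j : ℤ) = 2 * m then 1 else 0))
    (A : Matrix (Fin (4 * m)) (Fin (4 * m)) ℤ) (hA : A = compMat (4 * m) c) :
    Nonempty (jac (cone G) ≃+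
      coker (A ^ n - (2 * (k : ℤ) + 2) • 1 +
        ∑ j : Fin k, (A ^ (s j) + (Ring.inverse A) ^ (s j)))) := by
  classical
  have hN : 0 < 4 * m := by
    have := h1 ⟨k - 1, Nat.sub_lt hk one_pos⟩
    omega
  have hsm : ∀ l, s l ≤ m := by
    intro l
    rw [hm]
    apply hmono.monotone
    rw [Fin.le_def]
    simp only
    omega
  have hout : ∀ x, x < -(m : ℤ) ∨ (m : ℤ) < x → q x = 0 := by
    intro x hx
    rw [hq]
    simp only
    rw [if_neg (by omega), Finset.sum_eq_zero, sub_zero]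
    intro l _
    have := hsm l
    rw [if_neg (by omega), if_neg (by omega), add_zero]
  have hms : ∀ l, m = s l ↔ l = ⟨k - 1, Nat.sub_lt hk one_pos⟩ := by
    intro l
    rw [hm]
    exact ⟨fun h => (hmono.injective h).symm, fun h => by rw [h]⟩
  have hqm : q m = -1 := by
    rw [hq]
    simp only
    rw [if_neg (by omega), Finset.sum_eq_single ⟨k - 1, Nat.sub_lt hk one_pos⟩]
    · rw [if_pos (by rw [hm]), if_neg (by omega)]; rfl
    · intro l _ hl
      have := (hms l).not.2 hl
      rw [if_neg (by omega), if_neg (by omega), add_zero]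
    · simp
  have hqm' : q (-(m : ℤ)) = -1 := by
    rw [hq]
    simp only
    rw [if_neg (by omega), Finset.sum_eq_single ⟨k - 1, Nat.sub_lt hk one_pos⟩]
    · rw [if_neg (by omega), if_pos (by rw [hm])]; rfl
    · intro l _ hl
      have := (hms l).not.2 hl
      rw [if_neg (by omega), if_neg (by omega), add_zero]
    · simp
  have hc0 : c 0 = 1 := by
    rw [hc]
    simp only
    rw [if_neg (by push_cast; omega), Finset.sum_eq_single (-(m : ℤ))]
    · rw [hqm', show ((0 : ℕ) : ℤ) - 2 * m - -(m : ℤ) = -(m : ℤ) by push_cast; ring, hqm']; rfl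
    · intro t ht htm
      rw [Finset.mem_Icc] at ht
      rw [hout (((0 : ℕ) : ℤ) - 2 * m - t) (by push_cast; omega), mul_zero]
    · intro h; exact absurd (Finset.mem_Icc.2 ⟨le_refl _, by omega⟩) h
  have hcN : c (4 * m) = 1 := by
    rw [hc]
    simp only
    rw [if_neg (by push_cast; omega), Finset.sum_eq_single (m : ℤ)]
    · rw [hqm, show ((4 * m : ℕ) : ℤ) - 2 * m - (m : ℤ) = (m : ℤ) by push_cast; ring, hqm]; rfl
    · intro t ht htm
      rw [Finset.mem_Icc] at ht
      rw [hout (((4 * m : ℕ) : ℤ) - 2 * m - t) (by push_cast; omega), mul_zero]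
    · intro h; exact absurd (Finset.mem_Icc.2 ⟨by omega, le_refl _⟩) h
  have hP := sq_expand m q (polQ k s) (fun x => by rw [polQ_coeff, hq]) hout c hc
  obtain ⟨U, hU⟩ := compMat_isUnit (4 * m) c hN hc0
  -- the companion side
  obtain ⟨e1⟩ := comp_side (4 * m) c hN hc0 hcN U hU _ _ hP
    (LaurentPolynomial.T (n : ℤ) - polQ k s)
  have hM : evL U (LaurentPolynomial.T (n : ℤ) - polQ k s) =
      A ^ n - (2 * (k : ℤ) + 2) • 1 + ∑ j : Fin k, (A ^ (s j) + (Ring.inverse A) ^ (s j)) := by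
    rw [hA, ← hU, Ring.inverse_unit, polQ, map_sub, map_sub, map_smul, map_one, map_sum]
    simp only [map_add, evL_T, zpow_neg, zpow_natCast, ← inv_pow, Units.val_pow_eq_pow_val]
    abel
  rw [hM] at e1
  -- the graph side
  obtain ⟨e2⟩ := shift_side (2 * n) (polQ k s - LaurentPolynomial.T (n : ℤ))
  have hideal : (Ideal.span {(LaurentPolynomial.T ((2 * n : ℕ) : ℤ) - 1 : LaurentPolynomial ℤ)} ⊔
      Ideal.span {polQ k s - LaurentPolynomial.T (n : ℤ)}) =
      Ideal.span {polQ k s * polQ k s - 1} ⊔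
        Ideal.span {LaurentPolynomial.T (n : ℤ) - polQ k s} := by
    have hT : (LaurentPolynomial.T ((2 * n : ℕ) : ℤ) : LaurentPolynomial ℤ) =
        LaurentPolynomial.T (n : ℤ) * LaurentPolynomial.T (n : ℤ) := by
      rw [← LaurentPolynomial.T_add]; congr 1; push_cast; ring
    rw [hT, ← Ideal.span_insert, ← Ideal.span_insert]
    apply le_antisymm
    · rw [Ideal.span_le]
      rintro x (rfl | rfl)
      · exact Ideal.mem_span_pair.2
          ⟨1, polQ k s + LaurentPolynomial.T (n : ℤ), by ring⟩
      · exact Ideal.mem_span_pair.2 ⟨0, -1, by ring⟩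
    · rw [Ideal.span_le]
      rintro x (rfl | rfl)
      · exact Ideal.mem_span_pair.2
          ⟨1, polQ k s + LaurentPolynomial.T (n : ℤ), by ring⟩
      · exact Ideal.mem_span_pair.2 ⟨0, -1, by ring⟩
  rw [hideal] at e2
  have hJ := circ_J n k hn s hmono h1 h2
  have hadj : ∀ a b, G.Adj a b ↔
      ((∃ l, a - b = s l ∨ a - b = -(s l : ZMod (2 * n))) ∨ a - b = n) := by
    intro a b
    have hnn : -(n : ZMod (2 * n)) = n := by
      rw [neg_eq_iff_add_eq_zero]
      have := ZMod.natCast_self (2 * n)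
      push_cast at this
      rw [← this]; ring
    have hba : ∀ x : ZMod (2 * n), b - a = x ↔ a - b = -x := by
      intro x
      rw [← neg_sub a b, neg_eq_iff_eq_neg]
    have hne : ((∃ l, a - b = s l ∨ a - b = -(s l : ZMod (2 * n))) ∨ a - b = n) → a ≠ b := by
      rintro h rfl
      have hz : ∀ x : ℕ, 0 < x → x < 2 * n → (x : ZMod (2 * n)) ≠ 0 := by
        intro x hx hx' h
        rw [ZMod.natCast_eq_zero_iff] at h
        exact absurd (Nat.le_of_dvd hx h) (by omega)
      rw [sub_self] at h
      rcases h with ⟨l, h | h⟩ | h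
      · exact hz (s l) (h1 l) (by have := h2 l; omega) h.symm
      · exact hz (s l) (h1 l) (by have := h2 l; omega) (neg_eq_zero.1 h.symm)
      · exact hz n hn (by omega) h.symm
    rw [hGdef, SimpleGraph.circulantGraph_adj]
    simp only [Set.mem_union, Set.mem_range, Set.mem_singleton_iff, eq_comm (b := a - b),
      eq_comm (b := b - a)] at hne ⊢
    simp only [eq_comm (a := ((s _ : ℕ) : ZMod (2 * n))), eq_comm (a := ((n : ℕ) : ZMod (2 * n))),
      eq_comm (b := a - b), hba, hnn] at hne ⊢
    constructor
    · rintro ⟨_, (⟨l, h⟩ | h) | (⟨l, h⟩ | h)⟩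
      · exact Or.inl ⟨l, Or.inl h⟩
      · exact Or.inr h
      · exact Or.inl ⟨l, Or.inr h⟩
      · exact Or.inr h
    · intro h
      refine ⟨hne h, ?_⟩
      rcases h with ⟨l, h | h⟩ | h
      · exact Or.inl (Or.inl ⟨l, h⟩)
      · exact Or.inr (Or.inl ⟨l, h⟩)
      · exact Or.inl (Or.inr h)
  have hsum : ∀ (a g : ZMod (2 * n)), ∑ b, (if a - b = g then (1 : ℤ) else 0) = 1 := by
    intro a g
    rw [Finset.sum_eq_single (a - g)]
    · simp
    · intro b _ hb
      rw [if_neg]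
      rintro rfl
      exact hb (by ring)
    · simp
  obtain ⟨e3⟩ := jac_cone G
    (fun a b => (∑ l : Fin k, ((if a - b = (s l : ZMod (2 * n)) then (1 : ℤ) else 0) +
        (if a - b = -(s l : ZMod (2 * n)) then 1 else 0))) + (if a - b = n then 1 else 0))
    (2 * k + 1)
    (by
      intro a
      rw [Finset.sum_add_distrib, Finset.sum_comm, hsum]
      simp only [Finset.sum_add_distrib, hsum]
      simp
      ring)
    (fun a b h => (hJ (a - b)).1 ((hadj a b).1 h))
    (fun a b h => (hJ (a - b)).2 (fun h' => h ((hadj a b).2 h')))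
    (evL (shiftU (2 * n)) (polQ k s - LaurentPolynomial.T (n : ℤ)))
    (by
      intro a b
      have hab : ∀ g, a = b + g ↔ a - b = g := fun g => by rw [sub_eq_iff_eq_add']
      rw [polQ, map_sub, map_sub, map_smul, map_one, map_sum]
      simp only [map_add, evL_T, shiftU_zpow, Matrix.sub_apply, Matrix.smul_apply,
        Matrix.sum_apply, Matrix.add_apply, Matrix.one_apply, shiftMat, Matrix.of_apply, hab,
        Int.cast_neg, Int.cast_natCast, smul_eq_mul, mul_ite, mul_one, mul_zero]
      split_ifs <;> ring)
  exact ⟨e3.symm.trans (e2.symm.trans e1)⟩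
end

section
/- Let C₁ = Cₙ(s_{1,1},…,s_{1,k}) and C₂ = Cₙ(s_{2,1},…,s_{2,l}) be circulant graphs on n vertices, and let G be their cobordism (obtained by joining vertex i of C₁ to vertex i of C₂ for each i). Let G̃ be the cone over G. Then Jac(G̃) ≅ coker(𝒜ⁿ − I), where 𝒜 is the companion matrix of the Laurent polynomial (2k+2 − Σ_{r=1}^{k}(z^{s_{1,r}} + z^{−s_{1,r}}))·(2l+2 − Σ_{r=1}^{l}(z^{s_{2,r}} + z^{−s_{2,r}})) − 1. -/
open SimpleGraph

/-- The cobordism of two graphs on the same vertex set: their disjoint union together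
with a perfect matching joining corresponding vertices. -/
def cobordism {V : Type*} (G₁ G₂ : SimpleGraph V) : SimpleGraph (V ⊕ V) :=
  SimpleGraph.fromRel (fun x y =>
    (∃ a b, x = Sum.inl a ∧ y = Sum.inl b ∧ G₁.Adj a b) ∨
    (∃ a b, x = Sum.inr a ∧ y = Sum.inr b ∧ G₂.Adj a b) ∨
    (∃ a, x = Sum.inl a ∧ y = Sum.inr a))

open Polynomial in
theorem cyc_dvd {ι : Type*} [Fintype ι] (T : Module.End ℤ (ι → ℤ)) (v : ι → ℤ)
    (hcyc : ∀ w, ∃ f : ℤ[X], aeval T f v = w) (p : ℤ[X]) (hp : p.Monic)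
    (hdeg : p.natDegree = Fintype.card ι) (hpv : aeval T p v = 0) (f : ℤ[X]) :
    aeval T f v = 0 ↔ p ∣ f := by
  have hmul : ∀ g : ℤ[X], aeval T (p * g) v = 0 := by
    intro g
    rw [mul_comm, map_mul, Module.End.mul_apply, hpv, map_zero]
  have hmod : ∀ g : ℤ[X], aeval T (g %ₘ p) v = aeval T g v := by
    intro g
    conv_rhs => rw [← modByMonic_add_div g p]
    rw [map_add, LinearMap.add_apply, hmul, add_zero]
  have hlt : ∀ g : ℤ[X], g %ₘ p ∈ degreeLT ℤ (Fintype.card ι) := by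
    intro g
    rw [mem_degreeLT, ← hdeg, ← degree_eq_natDegree hp.ne_zero]
    exact degree_modByMonic_lt g hp
  let F : degreeLT ℤ (Fintype.card ι) →ₗ[ℤ] (ι → ℤ) :=
    { toFun := fun g => aeval T (g : ℤ[X]) v
      map_add' := by intro a b; simp
      map_smul' := by intro a b; simp }
  have hsurj : Function.Surjective F := by
    intro w
    obtain ⟨g, hg⟩ := hcyc w
    exact ⟨⟨g %ₘ p, hlt g⟩, by rw [← hg]; exact hmod g⟩
  let i : degreeLT ℤ (Fintype.card ι) ≃ₗ[ℤ] (ι → ℤ) :=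
    (degreeLTEquiv ℤ (Fintype.card ι)).trans
      (LinearEquiv.funCongrLeft ℤ ℤ (Fintype.equivFin ι))
  have hinj : Function.Injective F :=
    OrzechProperty.injective_of_surjective_of_injective i.toLinearMap F i.injective hsurj
  constructor
  · intro h
    rw [← modByMonic_eq_zero_iff_dvd hp]
    have h1 : F ⟨f %ₘ p, hlt f⟩ = F 0 := by
      rw [map_zero]
      exact (hmod f).trans h
    simpa using congrArg Subtype.val (hinj h1)
  · rintro ⟨g, rfl⟩
    exact hmul g

open Polynomial in
theorem coker_pres {ι : Type*} [Fintype ι] (T : Module.End ℤ (ι → ℤ)) (v : ι → ℤ)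
    (hcyc : ∀ w, ∃ f : ℤ[X], aeval T f v = w) (p : ℤ[X]) (hp : p.Monic)
    (hdeg : p.natDegree = Fintype.card ι) (hpv : aeval T p v = 0) (q : ℤ[X]) :
    ∃ F : ℤ[X] →ₗ[ℤ] ((ι → ℤ) ⧸ LinearMap.range (aeval T q)), Function.Surjective F ∧
      ∀ f, F f = 0 ↔ f ∈ Ideal.span {p, q} := by
  let F0 : ℤ[X] →ₗ[ℤ] (ι → ℤ) :=
    { toFun := fun g => aeval T (g : ℤ[X]) v
      map_add' := by intro a b; simp
      map_smul' := by intro a b; simp }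
  refine ⟨(Submodule.mkQ _).comp F0, ?_, ?_⟩
  · exact (Submodule.mkQ_surjective _).comp hcyc
  · intro f
    rw [LinearMap.comp_apply, Submodule.mkQ_apply, Submodule.Quotient.mk_eq_zero,
      Ideal.mem_span_pair]
    constructor
    · rintro ⟨w, hw⟩
      obtain ⟨g, rfl⟩ := hcyc w
      have : aeval T (f - q * g) v = 0 := by
        rw [map_sub, map_mul, LinearMap.sub_apply, Module.End.mul_apply, hw]
        exact sub_self _
      rw [cyc_dvd T v hcyc p hp hdeg hpv] at this
      obtain ⟨h, hh⟩ := this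
      exact ⟨h, g, by linear_combination -hh⟩
    · rintro ⟨a, b, rfl⟩
      refine ⟨aeval T b v, ?_⟩
      change _ = aeval T (a * p + b * q) v
      rw [map_add, map_mul, mul_comm b, map_mul, LinearMap.add_apply, Module.End.mul_apply, hpv,
        Module.End.mul_apply, map_zero, zero_add]

open Polynomial in
theorem coker_swap {ι κ : Type*} [Fintype ι] [Fintype κ] (T : Module.End ℤ (ι → ℤ)) (v : ι → ℤ)
    (S : Module.End ℤ (κ → ℤ)) (w : κ → ℤ)
    (hT : ∀ x, ∃ f : ℤ[X], aeval T f v = x) (hS : ∀ x, ∃ f : ℤ[X], aeval S f w = x)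
    (p q : ℤ[X]) (hp : p.Monic) (hq : q.Monic)
    (hpdeg : p.natDegree = Fintype.card ι) (hqdeg : q.natDegree = Fintype.card κ)
    (hpv : aeval T p v = 0) (hqw : aeval S q w = 0) :
    Nonempty (((ι → ℤ) ⧸ LinearMap.range (aeval T q)) ≃+
      ((κ → ℤ) ⧸ LinearMap.range (aeval S p))) := by
  obtain ⟨F, hF, hF'⟩ := coker_pres T v hT p hp hpdeg hpv q
  obtain ⟨G, hG, hG'⟩ := coker_pres S w hS q hq hqdeg hqw p
  have hk : LinearMap.ker F = LinearMap.ker G := by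
    ext f
    rw [LinearMap.mem_ker, LinearMap.mem_ker, hF', hG', Set.pair_comm]
  exact ⟨((F.quotKerEquivOfSurjective hF).symm.trans ((Submodule.quotEquivOfEq _ _ hk).trans
    (G.quotKerEquivOfSurjective hG))).toAddEquiv⟩

open Polynomial in
/-- The monic polynomial with given lower coefficients. -/
noncomputable def cpoly (s : ℕ) (c : ℕ → ℤ) : ℤ[X] :=
  X ^ s + ∑ j : Fin s, C (c j) * X ^ (j : ℕ)

open Polynomial in
theorem cpoly_deg (s : ℕ) (c : ℕ → ℤ) :
    (∑ j : Fin s, C (c j) * X ^ (j : ℕ) : ℤ[X]).degree < s := by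
  refine lt_of_le_of_lt (degree_sum_le _ _) ?_
  rw [Finset.sup_lt_iff (by exact WithBot.bot_lt_coe s)]
  intro j _
  exact lt_of_le_of_lt (degree_C_mul_X_pow_le _ _) (by exact_mod_cast j.2)

open Polynomial in
theorem cpoly_monic (s : ℕ) (c : ℕ → ℤ) : (cpoly s c).Monic :=
  monic_X_pow_add (cpoly_deg s c)

open Polynomial in
theorem cpoly_natDegree (s : ℕ) (c : ℕ → ℤ) : (cpoly s c).natDegree = s := by
  apply natDegree_eq_of_degree_eq_some
  rw [cpoly, degree_add_eq_left_of_degree_lt, degree_X_pow]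
  rw [degree_X_pow]
  exact cpoly_deg s c

theorem compMat_mulVec_last (s : ℕ) (c : ℕ → ℤ) (x : Fin s → ℤ) (i : Fin s) (hi : (i : ℕ) + 1 = s) :
    (compMat s c).mulVecLin x i = -∑ j : Fin _, c j * x j := by
  simp [Matrix.mulVec, dotProduct, compMat, hi]

theorem compMat_mulVec_lt (s : ℕ) (c : ℕ → ℤ) (x : Fin s → ℤ) (i : Fin s) (hi : (i : ℕ) + 1 < s) :
    (compMat s c).mulVecLin x i = x ⟨i + 1, hi⟩ := by
  simp only [Matrix.mulVecLin_apply, Matrix.mulVec, dotProduct, compMat, Matrix.of_apply, hi.ne,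
    if_false, ite_mul, one_mul, zero_mul]
  rw [Finset.sum_eq_single ⟨i + 1, hi⟩]
  · simp
  · intro b _ hb
    rw [if_neg]
    intro h
    exact hb (Fin.ext h)
  · simp

theorem compMat_pow (s : ℕ) (c : ℕ → ℤ) (i : ℕ) (x : Fin s → ℤ) (j : Fin s) (hi : j + i < s) :
    ((compMat s c).mulVecLin ^ i) x j = x ⟨j + i, hi⟩ := by
  induction i generalizing j with
  | zero => simp
  | succ i ih =>
    rw [pow_succ', Module.End.mul_apply, compMat_mulVec_lt _ _ _ _ (by omega), ih _ (by simp; omega)]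
    congr 1
    ext
    simp
    omega

theorem compMat_cpoly (s : ℕ) (hs : 0 < s) (c : ℕ → ℤ) (x : Fin s → ℤ) :
    Polynomial.aeval (compMat s c).mulVecLin (cpoly s c) x = 0 := by
  have h0 : ∀ x, Polynomial.aeval (compMat s c).mulVecLin (cpoly s c) x ⟨0, hs⟩ = 0 := by
    intro x
    obtain ⟨t, rfl⟩ : ∃ t, s = t + 1 := ⟨s - 1, by omega⟩
    simp only [cpoly, map_add, map_sum, map_mul, map_pow, Polynomial.aeval_X, Polynomial.aeval_C,
      LinearMap.add_apply, LinearMap.sum_apply, Module.End.mul_apply, Pi.add_apply, Finset.sum_apply]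
    have h2 : ((compMat (t+1) c).mulVecLin ^ (t + 1)) x ⟨0, hs⟩ = -∑ j : Fin _, c j * x j := by
      rw [pow_succ, Module.End.mul_apply, compMat_pow _ _ _ _ _ (by simp),
        compMat_mulVec_last _ _ _ _ (by simp)]
    rw [h2, neg_add_eq_zero]
    refine Finset.sum_congr rfl fun j _ => ?_
    have h3 := compMat_pow (t+1) c j x ⟨0, hs⟩ (by simp; omega)
    simp only [zero_add] at h3
    simp only [Module.algebraMap_end_apply, Pi.smul_apply, smul_eq_mul, h3]
  ext i
  have h1 := compMat_pow s c i (Polynomial.aeval (compMat s c).mulVecLin (cpoly s c) x) ⟨0, hs⟩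
    (by simp)
  simp only [zero_add] at h1
  rw [Pi.zero_apply, ← h1, ← h0 (((compMat s c).mulVecLin ^ (i : ℕ)) x)]
  rw [← Polynomial.aeval_X (R := ℤ) (compMat s c).mulVecLin, ← map_pow, Polynomial.aeval_X, 
    ← Module.End.mul_apply, ← Module.End.mul_apply, ← map_mul, ← map_mul, mul_comm]

/-- evaluation at an endomorphism and a vector -/
noncomputable def evalAt {ι : Type*} (T : Module.End ℤ (ι → ℤ)) (v : ι → ℤ) :
    Polynomial ℤ →ₗ[ℤ] (ι → ℤ) :=
  (LinearMap.applyₗ v).comp (Polynomial.aeval T).toLinearMap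

theorem evalAt_apply {ι : Type*} (T : Module.End ℤ (ι → ℤ)) (v : ι → ℤ) (f : Polynomial ℤ) :
    evalAt T v f = Polynomial.aeval T f v := rfl

theorem evalAt_cyc {ι : Type*} [Fintype ι] [DecidableEq ι] (T : Module.End ℤ (ι → ℤ)) (v : ι → ℤ)
    (h : ∀ i : ι, Pi.single i 1 ∈ LinearMap.range (evalAt T v)) (w : ι → ℤ) :
    ∃ f : Polynomial ℤ, Polynomial.aeval T f v = w := by
  have : w ∈ LinearMap.range (evalAt T v) := by
    have hw : w = ∑ i, w i • (Pi.single i 1 : ι → ℤ) := by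
      ext j
      simp [Finset.sum_apply, Pi.single_apply]
    rw [hw]
    exact Submodule.sum_mem _ fun i _ => Submodule.smul_mem _ _ (h i)
  exact this

theorem evalAt_step {ι : Type*} (T : Module.End ℤ (ι → ℤ)) (v x : ι → ℤ)
    (h : x ∈ LinearMap.range (evalAt T v)) : T x ∈ LinearMap.range (evalAt T v) := by
  obtain ⟨f, rfl⟩ := h
  exact ⟨Polynomial.X * f, by simp [evalAt_apply]⟩

theorem evalAt_self {ι : Type*} (T : Module.End ℤ (ι → ℤ)) (v : ι → ℤ) :
    v ∈ LinearMap.range (evalAt T v) := ⟨1, by simp [evalAt_apply]⟩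

theorem compMat_cyc (t : ℕ) (c : ℕ → ℤ) (w : Fin (t + 1) → ℤ) :
    ∃ f : Polynomial ℤ,
      Polynomial.aeval (compMat (t + 1) c).mulVecLin f (Pi.single (Fin.last t) 1) = w := by
  apply evalAt_cyc
  intro i
  induction i using Fin.reverseInduction with
  | last => exact evalAt_self _ _
  | cast i ih =>
    have h : (Pi.single i.castSucc 1 : Fin (t + 1) → ℤ) =
        (compMat (t + 1) c).mulVecLin (Pi.single i.succ 1)
          + c (i + 1) • (Pi.single (Fin.last t) 1 : Fin (t + 1) → ℤ) := by
      ext j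
      induction j using Fin.lastCases with
      | last =>
        rw [Pi.add_apply, compMat_mulVec_last _ _ _ _ (by simp)]
        rw [Finset.sum_eq_single i.succ (by intro b _ hb; simp [hb]) (by simp)]
        have hi := i.2
        simp [Fin.ext_iff, hi.ne']
      | cast j =>
        rw [Pi.add_apply, compMat_mulVec_lt _ _ _ _ (by simp)]
        have hj := j.2
        simp [Pi.single_apply, Fin.ext_iff, hj.ne]
    rw [h]
    exact Submodule.add_mem _ (evalAt_step _ _ _ ih) (Submodule.smul_mem _ _ (evalAt_self _ _))

/-- the cyclic shift -/
def shift (n : ℕ) : Module.End ℤ (ZMod n → ℤ) := LinearMap.funLeft ℤ ℤ (fun a => a - 1)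

theorem shift_pow (n j : ℕ) (x : ZMod n → ℤ) (a : ZMod n) : (shift n ^ j) x a = x (a - j) := by
  induction j generalizing a with
  | zero => simp
  | succ j ih =>
    rw [pow_succ', Module.End.mul_apply]
    change (shift n ^ j) x (a - 1) = _
    rw [ih]
    congr 1
    push_cast
    ring

theorem shift_cyc (n : ℕ) [NeZero n] (w : ZMod n → ℤ) :
    ∃ f : Polynomial ℤ, Polynomial.aeval (shift n) f (Pi.single 0 1) = w := by
  apply evalAt_cyc
  intro i
  refine ⟨Polynomial.X ^ i.val, ?_⟩
  ext a
  simp [evalAt_apply, shift_pow, Pi.single_apply, sub_eq_zero]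

theorem shift_ann (n : ℕ) (x : ZMod n → ℤ) :
    Polynomial.aeval (shift n) (Polynomial.X ^ n - 1 : Polynomial ℤ) x = 0 := by
  ext a
  simp [shift_pow]

theorem shift_cpoly (n s : ℕ) (c : ℕ → ℤ) (hc : c s = 1) (x : ZMod n → ℤ) (a : ZMod n) :
    Polynomial.aeval (shift n) (cpoly s c) x a =
      ∑ j ∈ Finset.range (s + 1), c j * x (a - j) := by
  rw [Finset.sum_range_succ, Finset.sum_range, hc]
  simp [cpoly, shift_pow]
  ring

theorem coker_comp_shift (n s : ℕ) [NeZero n] (hs : 0 < s) (c : ℕ → ℤ) :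
    Nonempty (((ZMod n → ℤ) ⧸ LinearMap.range (Polynomial.aeval (shift n) (cpoly s c))) ≃+
      coker (compMat s c ^ n - 1)) := by
  obtain ⟨t, rfl⟩ : ∃ t, s = t + 1 := ⟨s - 1, by omega⟩
  obtain ⟨e⟩ := coker_swap (shift n) (Pi.single 0 1) (compMat (t + 1) c).mulVecLin
    (Pi.single (Fin.last t) 1) (shift_cyc n) (compMat_cyc t c) (Polynomial.X ^ n - 1)
    (cpoly (t + 1) c) (Polynomial.monic_X_pow_sub_C 1 (NeZero.ne n)) (cpoly_monic _ _)
    ((Polynomial.natDegree_X_pow_sub_C (r := 1)).trans (ZMod.card n).symm)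
    ((cpoly_natDegree _ _).trans (Fintype.card_fin _).symm) (shift_ann n _)
    (compMat_cpoly _ hs _ _)
  have h : (Polynomial.aeval (compMat (t + 1) c).mulVecLin (Polynomial.X ^ n - 1 : Polynomial ℤ)) =
      (compMat (t + 1) c ^ n - 1).mulVecLin := by
    rw [← Matrix.toLin'_apply', ← Matrix.toLin'_apply', map_sub, map_sub, map_pow,
      Polynomial.aeval_X, map_one, Matrix.toLin'_one, Matrix.toLin'_pow]
    rfl
  rw [h] at e
  exact ⟨e⟩

open scoped Classical in
theorem lap_apply {V : Type*} [Fintype V] (G : SimpleGraph V) (x : V → ℤ) (v : V) :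
    (lap G).mulVecLin x v = ∑ u, if G.Adj v u then x v - x u else 0 := by
  rw [Matrix.mulVecLin_apply, lap, SimpleGraph.lapMatrix_mulVec_apply, ← Finset.sum_filter,
    Finset.sum_sub_distrib, ← SimpleGraph.neighborFinset_eq_filter]
  simp

theorem lap_sum {V : Type*} [Fintype V] (G : SimpleGraph V) (x : V → ℤ) :
    ∑ v, (lap G).mulVecLin x v = 0 := by
  classical
  have h : ∑ v, (lap G).mulVecLin x v = - ∑ v, (lap G).mulVecLin x v := by
    simp only [lap_apply]
    conv_lhs => rw [Finset.sum_comm]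
    rw [← Finset.sum_neg_distrib]
    refine Finset.sum_congr rfl fun u _ => ?_
    rw [← Finset.sum_neg_distrib]
    refine Finset.sum_congr rfl fun v _ => ?_
    simp only [G.adj_comm v u]
    split_ifs <;> ring
  omega

/-- reduced Laplacian of the cone -/
noncomputable def redLap {V : Type*} [Fintype V] (G : SimpleGraph V) : Module.End ℤ (V → ℤ) :=
  (lap G).mulVecLin + 1

theorem redLap_apply {V : Type*} [Fintype V] (G : SimpleGraph V) (x : V → ℤ) (v : V) :
    redLap G x v = (lap G).mulVecLin x v + x v := rfl

theorem lap_cone_apply {V : Type*} [Fintype V] (G : SimpleGraph V) (x : Option V → ℤ) (v : V) :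
    (lap (cone G)).mulVecLin x (some v) = redLap G (fun v => x (some v)) v - x none := by
  classical
  rw [redLap_apply, lap_apply, lap_apply, Fintype.sum_option]
  have h1 : (cone G).Adj (some v) none := by simp [cone]
  have h2 : ∀ u, (cone G).Adj (some v) (some u) ↔ G.Adj v u := by
    intro u
    simp only [cone, fromRel_adj]
    constructor
    · rintro ⟨-, h⟩
      simpa [G.adj_comm u v] using h
    · intro h
      refine ⟨by simpa using h.ne, Or.inl (by simpa using h)⟩
  simp only [h1, h2, if_true]
  ring

theorem redLap_le {V : Type*} [Fintype V] (G : SimpleGraph V) (x : V → ℤ) (hx : redLap G x = 0)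
    (v : V) : x v ≤ 0 := by
  classical
  have : Nonempty V := ⟨v⟩
  obtain ⟨w, hw⟩ := Finite.exists_max x
  have h := congrFun hx w
  rw [redLap_apply, lap_apply, Pi.zero_apply] at h
  have h2 : 0 ≤ ∑ u, if G.Adj w u then x w - x u else 0 := by
    refine Finset.sum_nonneg fun u _ => ?_
    have := hw u
    split_ifs <;> omega
  have := hw v
  omega

theorem redLap_one {V : Type*} [Fintype V] (G : SimpleGraph V) (a : ℤ) :
    redLap G (fun _ => a) = fun _ => a := by
  ext v
  rw [redLap_apply, lap_apply]
  simp

theorem redLap_torsion {V : Type*} [Fintype V] (G : SimpleGraph V) :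
    ∃ d : ℤ, d ≠ 0 ∧ ∀ y, d • y ∈ LinearMap.range (redLap G) := by
  classical
  have hM : ∀ x, (lap G + 1).mulVec x = redLap G x := by
    intro x
    rw [Matrix.add_mulVec, Matrix.one_mulVec]
    rfl
  refine ⟨(lap G + 1).det, ?_, ?_⟩
  · intro h
    obtain ⟨x, hx0, hx⟩ := Matrix.exists_mulVec_eq_zero_iff.mpr h
    rw [hM] at hx
    apply hx0
    ext v
    have h1 := redLap_le G x hx v
    have h2 := redLap_le G (-x) (by rw [map_neg, hx, neg_zero]) v
    simp only [Pi.neg_apply, Pi.zero_apply] at *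
    omega
  · intro y
    refine ⟨(lap G + 1).adjugate.mulVec y, ?_⟩
    rw [← hM, Matrix.mulVec_mulVec, Matrix.mul_adjugate, Matrix.smul_mulVec, Matrix.one_mulVec]

theorem jac_cone_s11 {V : Type*} [Fintype V] (G : SimpleGraph V) :
    Nonempty (jac (cone G) ≃+ ((V → ℤ) ⧸ LinearMap.range (redLap G))) := by
  let L := (lap (cone G)).mulVecLin
  let N := LinearMap.range L
  have hjac : jac (cone G) = Submodule.torsion ℤ ((Option V → ℤ) ⧸ N) := rfl
  let res : (Option V → ℤ) →ₗ[ℤ] (V → ℤ) := LinearMap.funLeft ℤ ℤ some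
  have hres : ∀ y, res (L y) ∈ LinearMap.range (redLap G) := by
    intro y
    refine ⟨res y - fun _ => y none, ?_⟩
    rw [map_sub, redLap_one]
    ext v
    exact (lap_cone_apply G y v).symm
  let F : ((Option V → ℤ) ⧸ N) →ₗ[ℤ] ((V → ℤ) ⧸ LinearMap.range (redLap G)) :=
    Submodule.mapQ _ _ res (by rintro _ ⟨y, rfl⟩; exact hres y)
  have hF : ∀ x, F (Submodule.Quotient.mk x) = Submodule.Quotient.mk (res x) := fun x => rfl
  -- the degree-zero part injects
  have key : ∀ x : Option V → ℤ, ∑ v, x v = 0 → res x ∈ LinearMap.range (redLap G) → x ∈ N := by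
    rintro x hx ⟨y, hy⟩
    refine ⟨fun o => o.elim 0 y, ?_⟩
    have hs : ∀ v, L (fun o => o.elim 0 y) (some v) = x (some v) := by
      intro v
      have h1 := lap_cone_apply G (fun o => o.elim 0 y) v
      have h2 := congrFun hy v
      simp only [Option.elim, sub_zero] at h1
      exact h1.trans h2
    have hsum : ∑ v, L (fun o => o.elim 0 y) v = 0 := lap_sum _ _
    rw [Fintype.sum_option] at hsum hx
    simp only [hs] at hsum
    ext o
    cases o with
    | none => linarith
    | some v => exact hs v
  have hdeg : ∀ x : Option V → ℤ, ∀ a : ℤ, a ≠ 0 → a • x ∈ N → ∑ v, x v = 0 := by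
    rintro x a ha ⟨y, hy⟩
    have hsum : ∑ v, L y v = 0 := lap_sum _ _
    rw [hy] at hsum
    simp only [Pi.smul_apply, smul_eq_mul, ← Finset.mul_sum] at hsum
    exact (mul_eq_zero.mp hsum).resolve_left ha
  obtain ⟨d, hd, hd'⟩ := redLap_torsion G
  let F' : Submodule.torsion ℤ ((Option V → ℤ) ⧸ N) →ₗ[ℤ] _ := F.comp (Submodule.subtype _)
  have hbij : Function.Bijective F' := by
    constructor
    · rw [injective_iff_map_eq_zero]
      rintro ⟨q, hq⟩ h
      obtain ⟨x, rfl⟩ := Submodule.Quotient.mk_surjective _ q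
      obtain ⟨⟨a, ha⟩, h2⟩ := hq
      have h3 : a • x ∈ N := by
        rw [← Submodule.Quotient.mk_eq_zero, Submodule.Quotient.mk_smul]
        exact h2
      have h4 := hdeg x a (nonZeroDivisors.ne_zero ha) h3
      have h5 : res x ∈ LinearMap.range (redLap G) := by
        rw [← Submodule.Quotient.mk_eq_zero]
        exact h
      have h6 := key x h4 h5
      apply Subtype.ext
      exact (Submodule.Quotient.mk_eq_zero _).mpr h6
    · intro q
      obtain ⟨y, rfl⟩ := Submodule.Quotient.mk_surjective _ q
      let x : Option V → ℤ := fun o => o.elim (-∑ v, y v) y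
      have hx : ∑ v, x v = 0 := by
        rw [Fintype.sum_option]
        simp [x]
      have hN : d • x ∈ N := by
        apply key
        · simp only [Pi.smul_apply, ← Finset.smul_sum, hx, smul_zero]
        · exact hd' y
      refine ⟨⟨Submodule.Quotient.mk x, ⟨⟨d, mem_nonZeroDivisors_of_ne_zero hd⟩, ?_⟩⟩, rfl⟩
      change d • Submodule.Quotient.mk x = (0 : (Option V → ℤ) ⧸ N)
      rw [← Submodule.Quotient.mk_smul]
      exact (Submodule.Quotient.mk_eq_zero _).mpr hN
  exact ⟨(LinearEquiv.ofBijective F' hbij).toAddEquiv⟩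

/-- shifted circulant Laplacian -/
def circOp (n k : ℕ) (s : Fin k → ℕ) : Module.End ℤ (ZMod n → ℤ) where
  toFun x a := (2 * k + 2) * x a - ∑ r, (x (a - s r) + x (a + s r))
  map_add' x y := by
    ext a
    simp only [Pi.add_apply, Finset.sum_add_distrib]
    ring
  map_smul' b x := by
    ext a
    simp only [Pi.smul_apply, smul_eq_mul, Finset.sum_add_distrib, ← Finset.mul_sum, RingHom.id_apply]
    ring

theorem circOp_apply (n k : ℕ) (s : Fin k → ℕ) (x : ZMod n → ℤ) (a : ZMod n) :
    circOp n k s x a = (2 * k + 2) * x a - ∑ r, (x (a - s r) + x (a + s r)) := rfl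

open scoped Classical in
theorem circ_sum (n k : ℕ) [NeZero n] (s : Fin k → ℕ) (hmono : StrictMono s) (h1 : ∀ r, 1 ≤ s r)
    (h2 : ∀ r, 2 * s r < n) (g : ZMod n → ℤ) (a : ZMod n) :
    (∑ u, if (circulantGraph (Set.range fun r : Fin k => ((s r : ZMod n)))).Adj a u
      then g u else 0) = ∑ r, (g (a - s r) + g (a + s r)) := by
  have hne : ∀ r r', ((s r : ZMod n)) + s r' ≠ 0 := by
    intro r r' h
    have h3 : ((s r + s r' : ℕ) : ZMod n) = 0 := by push_cast; exact h
    rw [ZMod.natCast_eq_zero_iff] at h3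
    have := Nat.le_of_dvd (by have := h1 r; omega) h3
    have := h2 r
    have := h2 r'
    omega
  have hne0 : ∀ r, ((s r : ZMod n)) ≠ 0 := by
    intro r h3
    rw [ZMod.natCast_eq_zero_iff] at h3
    have := Nat.le_of_dvd (by have := h1 r; omega) h3
    have := h2 r
    omega
  have hinj : ∀ r r', ((s r : ZMod n)) = s r' → r = r' := by
    intro r r' h
    apply hmono.injective
    rw [ZMod.natCast_eq_natCast_iff'] at h
    have := h2 r
    have := h2 r'
    rwa [Nat.mod_eq_of_lt (by omega), Nat.mod_eq_of_lt (by omega)] at h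
  let φ : Fin k ⊕ Fin k → ZMod n := Sum.elim (fun r => a - s r) (fun r => a + s r)
  have hφ : Function.Injective φ := by
    rintro (r | r) (r' | r') h
    · simp only [φ, Sum.elim_inl, sub_right_inj] at h
      rw [hinj _ _ h]
    · simp only [φ, Sum.elim_inl, Sum.elim_inr] at h
      exact absurd (by linear_combination -h) (hne r r')
    · simp only [φ, Sum.elim_inl, Sum.elim_inr] at h
      exact absurd (by linear_combination h) (hne r r')
    · simp only [φ, Sum.elim_inr, add_right_inj] at h
      rw [hinj _ _ h]
  have hR : ∑ r, (g (a - s r) + g (a + s r)) = ∑ i, g (φ i) := by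
    rw [Fintype.sum_sum_type, Finset.sum_add_distrib]
    rfl
  rw [hR, ← Finset.sum_filter, ← Finset.sum_image (s := Finset.univ) (g := φ) (f := g) hφ.injOn]
  refine Finset.sum_congr ?_ fun _ _ => rfl
  ext u
  simp only [Finset.mem_filter, Finset.mem_univ, true_and, Finset.mem_image, circulantGraph,
    fromRel_adj, Set.mem_range]
  constructor
  · rintro ⟨-, ⟨r, hr⟩ | ⟨r, hr⟩⟩
    · exact ⟨Sum.inl r, by simp only [φ, Sum.elim_inl]; rw [hr]; ring⟩
    · exact ⟨Sum.inr r, by simp only [φ, Sum.elim_inr]; rw [hr]; ring⟩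
  · rintro ⟨r | r, rfl⟩
    · simp only [φ, Sum.elim_inl]
      refine ⟨fun h => hne0 r (by linear_combination h), Or.inl ⟨r, by ring⟩⟩
    · simp only [φ, Sum.elim_inr]
      refine ⟨fun h => hne0 r (by linear_combination -h), Or.inr ⟨r, by ring⟩⟩

theorem cob_ll {V : Type*} (G₁ G₂ : SimpleGraph V) (a b : V) :
    (cobordism G₁ G₂).Adj (Sum.inl a) (Sum.inl b) ↔ G₁.Adj a b := by
  simp only [cobordism, fromRel_adj]
  constructor
  · rintro ⟨-, h⟩
    simpa [G₁.adj_comm b a] using h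
  · intro h
    exact ⟨by simpa using h.ne, Or.inl (by simpa using h)⟩

theorem cob_rr {V : Type*} (G₁ G₂ : SimpleGraph V) (a b : V) :
    (cobordism G₁ G₂).Adj (Sum.inr a) (Sum.inr b) ↔ G₂.Adj a b := by
  simp only [cobordism, fromRel_adj]
  constructor
  · rintro ⟨-, h⟩
    simpa [G₂.adj_comm b a] using h
  · intro h
    exact ⟨by simpa using h.ne, Or.inl (by simpa using h)⟩

theorem cob_lr {V : Type*} (G₁ G₂ : SimpleGraph V) (a b : V) :
    (cobordism G₁ G₂).Adj (Sum.inl a) (Sum.inr b) ↔ b = a := by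
  simp [cobordism, fromRel_adj]

theorem cob_rl {V : Type*} (G₁ G₂ : SimpleGraph V) (a b : V) :
    (cobordism G₁ G₂).Adj (Sum.inr a) (Sum.inl b) ↔ b = a := by
  rw [SimpleGraph.adj_comm, cob_lr, eq_comm]

theorem redLap_cob (n k l : ℕ) [NeZero n] (s₁ : Fin k → ℕ) (hmono₁ : StrictMono s₁)
    (h11 : ∀ r, 1 ≤ s₁ r) (h12 : ∀ r, 2 * s₁ r < n)
    (s₂ : Fin l → ℕ) (hmono₂ : StrictMono s₂) (h21 : ∀ r, 1 ≤ s₂ r) (h22 : ∀ r, 2 * s₂ r < n)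
    (z : ZMod n ⊕ ZMod n → ℤ) (a : ZMod n) :
    redLap (cobordism (circulantGraph (Set.range fun r : Fin k => ((s₁ r : ZMod n))))
      (circulantGraph (Set.range fun r : Fin l => ((s₂ r : ZMod n))))) z (Sum.inl a) =
      circOp n k s₁ (fun b => z (Sum.inl b)) a - z (Sum.inr a) ∧
    redLap (cobordism (circulantGraph (Set.range fun r : Fin k => ((s₁ r : ZMod n))))
      (circulantGraph (Set.range fun r : Fin l => ((s₂ r : ZMod n))))) z (Sum.inr a) =
      circOp n l s₂ (fun b => z (Sum.inr b)) a - z (Sum.inl a) := by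
  classical
  constructor
  · rw [redLap_apply, lap_apply, Fintype.sum_sum_type]
    simp only [cob_ll, cob_lr]
    have h := circ_sum n k s₁ hmono₁ h11 h12 (fun u => z (Sum.inl a) - z (Sum.inl u)) a
    rw [h, circOp_apply, Finset.sum_ite_eq' Finset.univ a]
    simp only [Finset.sum_add_distrib, Finset.sum_sub_distrib, Finset.sum_const, Finset.card_univ,
      Fintype.card_fin, Finset.mem_univ, if_true, nsmul_eq_mul]
    ring
  · rw [redLap_apply, lap_apply, Fintype.sum_sum_type]
    simp only [cob_rr, cob_rl]
    have h := circ_sum n l s₂ hmono₂ h21 h22 (fun u => z (Sum.inr a) - z (Sum.inr u)) a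
    rw [h, circOp_apply, Finset.sum_ite_eq' Finset.univ a]
    simp only [Finset.sum_add_distrib, Finset.sum_sub_distrib, Finset.sum_const, Finset.card_univ,
      Fintype.card_fin, Finset.mem_univ, if_true, nsmul_eq_mul]
    ring

theorem coker_elim {ι : Type*} (D : Module.End ℤ (ι ⊕ ι → ℤ)) (D₁ D₂ : Module.End ℤ (ι → ℤ))
    (hl : ∀ z a, D z (Sum.inl a) = D₁ (fun b => z (Sum.inl b)) a - z (Sum.inr a))
    (hr : ∀ z a, D z (Sum.inr a) = D₂ (fun b => z (Sum.inr b)) a - z (Sum.inl a)) :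
    Nonempty (((ι ⊕ ι → ℤ) ⧸ LinearMap.range D) ≃+
      ((ι → ℤ) ⧸ LinearMap.range (D₁ * D₂ - 1))) := by
  let pl : (ι ⊕ ι → ℤ) →ₗ[ℤ] (ι → ℤ) := LinearMap.funLeft ℤ ℤ Sum.inl
  let pr : (ι ⊕ ι → ℤ) →ₗ[ℤ] (ι → ℤ) := LinearMap.funLeft ℤ ℤ Sum.inr
  have hl' : ∀ z, pl (D z) = D₁ (pl z) - pr z := fun z => funext fun a => hl z a
  have hr' : ∀ z, pr (D z) = D₂ (pr z) - pl z := fun z => funext fun a => hr z a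
  let F0 : (ι ⊕ ι → ℤ) →ₗ[ℤ] (ι → ℤ) := pl + D₁.comp pr
  have hF0 : ∀ z, F0 z = pl z + D₁ (pr z) := fun z => rfl
  let F := (Submodule.mkQ (LinearMap.range (D₁ * D₂ - 1))).comp F0
  have hsurj : Function.Surjective F := by
    refine (Submodule.mkQ_surjective _).comp ?_
    intro x
    refine ⟨Sum.elim x 0, ?_⟩
    have h1 : pl (Sum.elim x 0) = x := rfl
    have h2 : pr (Sum.elim x 0) = 0 := rfl
    rw [hF0, h1, h2, map_zero, add_zero]
  have hker : LinearMap.ker F = LinearMap.range D := by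
    ext z
    rw [LinearMap.mem_ker, LinearMap.comp_apply, Submodule.mkQ_apply,
      Submodule.Quotient.mk_eq_zero, hF0]
    constructor
    · rintro ⟨w, hw⟩
      rw [LinearMap.sub_apply, Module.End.mul_apply, Module.End.one_apply] at hw
      let y : ι ⊕ ι → ℤ := Sum.elim (D₂ w - pr z) w
      have h1 : pl y = D₂ w - pr z := rfl
      have h2 : pr y = w := rfl
      have e1 := hl' y
      have e2 := hr' y
      rw [h1, h2, map_sub] at e1
      rw [h1, h2] at e2
      have e1' : pl (D y) = pl z := by
        rw [e1, sub_right_comm, hw]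
        abel
      have e2' : pr (D y) = pr z := by
        rw [e2]
        abel
      refine ⟨y, ?_⟩
      ext i
      cases i with
      | inl a => exact congrFun e1' a
      | inr a => exact congrFun e2' a
    · rintro ⟨y, rfl⟩
      refine ⟨pr y, ?_⟩
      rw [hl', hr', LinearMap.sub_apply, Module.End.mul_apply, Module.End.one_apply, map_sub]
      abel
  exact ⟨((Submodule.quotEquivOfEq _ _ hker.symm).trans
    (F.quotKerEquivOfSurjective hsurj)).toAddEquiv⟩

/-- coefficients of the factor -/
def qco (k : ℕ) (s : Fin k → ℕ) (t : ℤ) : ℤ := (if t = 0 then (2 * (k : ℤ) + 2) else 0) -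
      ∑ r : Fin k, ((if t = (s r : ℤ) then 1 else 0) + (if t = -(s r : ℤ) then 1 else 0))

theorem qco_zero (k : ℕ) (s : Fin k → ℕ) (m : ℕ) (hm : ∀ r, s r ≤ m) (t : ℤ)
    (ht : t ∉ Finset.Icc (-(m : ℤ)) m) : qco k s t = 0 := by
  rw [Finset.mem_Icc] at ht
  rw [qco, if_neg (by omega), Finset.sum_eq_zero, sub_zero]
  intro r _
  have := hm r
  rw [if_neg (by omega), if_neg (by omega), add_zero]

theorem qco_top (k : ℕ) (s : Fin k → ℕ) (hs : StrictMono s) (h1 : ∀ r, 1 ≤ s r) (r : Fin k) :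
    qco k s (s r) = -1 := by
  have := h1 r
  rw [qco, if_neg (by omega), Finset.sum_eq_single r]
  · rw [if_pos rfl, if_neg (by omega)]
    ring
  · intro b _ hb
    have h2 := h1 b
    have h3 : s r ≠ s b := fun h => hb (hs.injective h).symm
    rw [if_neg (by omega), if_neg (by omega), add_zero]
  · simp

theorem circOp_eq (n k : ℕ) (s : Fin k → ℕ) (m : ℕ) (hm : ∀ r, s r ≤ m) (x : ZMod n → ℤ)
    (a : ZMod n) :
    circOp n k s x a = ∑ t ∈ Finset.Icc (-(m : ℤ)) m, qco k s t * x (a - (t : ℤ)) := by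
  rw [circOp_apply]
  simp only [qco, sub_mul, Finset.sum_mul, Finset.sum_sub_distrib, add_mul, ite_mul, zero_mul,
    one_mul]
  rw [Finset.sum_comm (s := Finset.Icc (-(m : ℤ)) m), Finset.sum_ite_eq' _ (0 : ℤ),
    if_pos (by simp)]
  congr 1
  · simp
  · refine Finset.sum_congr rfl fun r _ => ?_
    have := hm r
    rw [Finset.sum_add_distrib, Finset.sum_ite_eq' _ (s r : ℤ), Finset.sum_ite_eq' _ (-(s r : ℤ)),
      if_pos (by rw [Finset.mem_Icc]; omega), if_pos (by rw [Finset.mem_Icc]; omega)]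
    simp

theorem conv_sum (m₁ m₂ : ℕ) (q₁ q₂ F : ℤ → ℤ)
    (h2 : ∀ t, t ∉ Finset.Icc (-(m₂ : ℤ)) m₂ → q₂ t = 0) :
    ∑ t ∈ Finset.Icc (-(m₁ : ℤ)) m₁, q₁ t * ∑ u ∈ Finset.Icc (-(m₂ : ℤ)) m₂, q₂ u * F (t + u) =
    ∑ j ∈ Finset.range (2 * (m₁ + m₂) + 1),
      (∑ t ∈ Finset.Icc (-(m₁ : ℤ)) m₁, q₁ t * q₂ ((j : ℤ) - (m₁ + m₂) - t)) *
        F ((j : ℤ) - (m₁ + m₂)) := by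
  simp only [Finset.sum_mul]
  rw [Finset.sum_comm]
  refine Finset.sum_congr rfl fun t ht => ?_
  rw [Finset.mem_Icc] at ht
  rw [Finset.mul_sum]
  refine Finset.sum_of_injOn (fun u : ℤ => (u + t + (m₁ + m₂)).toNat) ?_ ?_ ?_ ?_
  · intro u hu v hv h
    simp only [Finset.coe_Icc, Set.mem_Icc] at hu hv h
    omega
  · intro u hu
    simp only [Finset.coe_Icc, Set.mem_Icc, Finset.coe_range, Set.mem_Iio] at *
    omega
  · intro j hj hj'
    rw [h2, mul_zero, zero_mul]
    intro h
    apply hj'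
    refine ⟨_, h, ?_⟩
    simp
  · intro u hu
    simp only [Finset.mem_Icc] at hu
    have e : (((u + t + (m₁ + m₂)).toNat : ℕ) : ℤ) = u + t + (m₁ + m₂) := by
      apply Int.toNat_of_nonneg
      omega
    simp only [e]
    rw [mul_assoc]
    congr 3 <;> ring_nf

/-- Jacobian of the cone over the cobordism of two circulant graphs
`C₁ = Cₙ(s₁,…)` and `C₂ = Cₙ(s₂,…)`: it is isomorphic to `coker (𝒜ⁿ - I)`, where `𝒜`
is the companion matrix of the Laurent polynomial
`(2k+2 - ∑ᵣ (z^{s_{1,r}} + z^{-s_{1,r}})) (2l+2 - ∑ᵣ (z^{s_{2,r}} + z^{-s_{2,r}})) - 1`,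
whose coefficient sequence is written out explicitly below. -/
theorem jac_cone_cobordism
    (n k l : ℕ) [NeZero n] (hk : 0 < k) (hl : 0 < l)
    (s₁ : Fin k → ℕ) (hmono₁ : StrictMono s₁) (h11 : ∀ r, 1 ≤ s₁ r) (h12 : ∀ r, 2 * s₁ r < n)
    (s₂ : Fin l → ℕ) (hmono₂ : StrictMono s₂) (h21 : ∀ r, 1 ≤ s₂ r) (h22 : ∀ r, 2 * s₂ r < n)
    (C₁ C₂ : SimpleGraph (ZMod n))
    (hC₁ : C₁ = circulantGraph (Set.range fun r : Fin k => ((s₁ r : ZMod n))))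
    (hC₂ : C₂ = circulantGraph (Set.range fun r : Fin l => ((s₂ r : ZMod n))))
    (G : SimpleGraph (ZMod n ⊕ ZMod n)) (hG : G = cobordism C₁ C₂)
    (m₁ m₂ : ℕ) (hm₁ : m₁ = s₁ ⟨k - 1, Nat.sub_lt hk one_pos⟩)
    (hm₂ : m₂ = s₂ ⟨l - 1, Nat.sub_lt hl one_pos⟩)
    (q₁ q₂ : ℤ → ℤ)
    (hq₁ : q₁ = fun t => (if t = 0 then (2 * (k : ℤ) + 2) else 0) -
      ∑ r : Fin k, ((if t = (s₁ r : ℤ) then 1 else 0) + (if t = -(s₁ r : ℤ) then 1 else 0)))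
    (hq₂ : q₂ = fun t => (if t = 0 then (2 * (l : ℤ) + 2) else 0) -
      ∑ r : Fin l, ((if t = (s₂ r : ℤ) then 1 else 0) + (if t = -(s₂ r : ℤ) then 1 else 0)))
    (c : ℕ → ℤ)
    (hc : c = fun (j : ℕ) =>
      (∑ t ∈ Finset.Icc (-(m₁ : ℤ)) (m₁ : ℤ), q₁ t * q₂ ((j : ℤ) - (m₁ + m₂) - t)) -
      (if (j : ℤ) = m₁ + m₂ then 1 else 0)) :
    Nonempty (jac (cone G) ≃+ coker (compMat (2 * (m₁ + m₂)) c ^ n - 1)) := by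
  subst hC₁ hC₂ hG
  have hle₁ : ∀ r, s₁ r ≤ m₁ := by
    intro r
    rw [hm₁]
    apply hmono₁.monotone
    rw [Fin.le_def]
    simp only
    omega
  have hle₂ : ∀ r, s₂ r ≤ m₂ := by
    intro r
    rw [hm₂]
    apply hmono₂.monotone
    rw [Fin.le_def]
    simp only
    omega
  have hq₁' : q₁ = qco k s₁ := hq₁
  have hq₂' : q₂ = qco l s₂ := hq₂
  have hpos : 0 < m₁ := by rw [hm₁]; exact h11 _
  have htop₁ : q₁ m₁ = -1 := by rw [hq₁', hm₁]; exact qco_top k s₁ hmono₁ h11 _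
  have htop₂ : q₂ m₂ = -1 := by rw [hq₂', hm₂]; exact qco_top l s₂ hmono₂ h21 _
  have hcs : c (2 * (m₁ + m₂)) = 1 := by
    rw [hc]
    simp only
    rw [if_neg (by push_cast; omega), Finset.sum_eq_single (m₁ : ℤ)]
    · have : (((2 * (m₁ + m₂) : ℕ) : ℤ) - (m₁ + m₂) - m₁) = m₂ := by push_cast; ring
      rw [this, htop₁, htop₂]
      norm_num
    · intro t ht htne
      rw [Finset.mem_Icc] at ht
      rw [hq₂', qco_zero l s₂ m₂ hle₂, mul_zero]
      rw [Finset.mem_Icc]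
      push_cast
      omega
    · intro h
      exact absurd (Finset.mem_Icc.mpr (by omega)) h
  let U : Module.End ℤ (ZMod n → ℤ) := LinearMap.funLeft ℤ ℤ (fun a => a + ((m₁ + m₂ : ℕ) : ZMod n))
  have hUs : LinearMap.range U = ⊤ := by
    rw [LinearMap.range_eq_top]
    intro x
    refine ⟨fun a => x (a - ((m₁ + m₂ : ℕ) : ZMod n)), ?_⟩
    ext a
    exact congrArg x (by ring)
  have hop : circOp n k s₁ * circOp n l s₂ - 1 =
      (Polynomial.aeval (shift n) (cpoly (2 * (m₁ + m₂)) c)).comp U := by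
    refine LinearMap.ext fun x => funext fun a => ?_
    rw [LinearMap.comp_apply, shift_cpoly n _ c hcs, LinearMap.sub_apply, Module.End.mul_apply,
      Module.End.one_apply, Pi.sub_apply, circOp_eq n k s₁ m₁ hle₁]
    simp only [circOp_eq n l s₂ m₂ hle₂]
    have h := conv_sum m₁ m₂ q₁ q₂ (fun t => x (a - (t : ℤ)))
      (by rw [hq₂']; exact qco_zero l s₂ m₂ hle₂)
    simp only [← hq₁', ← hq₂']
    have e1 : ∀ t u : ℤ, a - (t : ZMod n) - (u : ZMod n) = a - ((t + u : ℤ) : ZMod n) := by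
      intro t u
      push_cast
      ring
    simp only [e1]
    rw [h, hc]
    simp only [sub_mul, Finset.sum_sub_distrib]
    have e2 : ∀ j : ℕ, U x (a - j) = x (a - (((j : ℤ) - (m₁ + m₂) : ℤ) : ZMod n)) := by
      intro j
      refine congrArg x ?_
      push_cast
      ring
    simp only [e2]
    congr 1
    rw [Finset.sum_eq_single (m₁ + m₂)]
    · simp
    · intro b _ hb
      rw [if_neg (by omega), zero_mul]
    · intro h
      exact absurd (Finset.mem_range.mpr (by omega)) h
  obtain ⟨e₁⟩ := jac_cone_s11 (cobordism (circulantGraph (Set.range fun r : Fin k => ((s₁ r : ZMod n))))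
      (circulantGraph (Set.range fun r : Fin l => ((s₂ r : ZMod n)))))
  obtain ⟨e₂⟩ := coker_elim _ (circOp n k s₁) (circOp n l s₂)
    (fun z a => (redLap_cob n k l s₁ hmono₁ h11 h12 s₂ hmono₂ h21 h22 z a).1)
    (fun z a => (redLap_cob n k l s₁ hmono₁ h11 h12 s₂ hmono₂ h21 h22 z a).2)
  obtain ⟨e₃⟩ := coker_comp_shift n (2 * (m₁ + m₂)) (by omega) c
  rw [hop, LinearMap.range_comp_of_range_eq_top _ hUs] at e₂
  exact ⟨(e₁.trans e₂).trans e₃⟩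
end

section
/- The number of spanning trees of the wheel graph W(n) (the cone over the cycle Cₙ) equals 2Tₙ(3/2) − 2, where Tₙ is the Chebyshev polynomial of the first kind. Equivalently, τ(W(n)) = ((3+√5)/2)ⁿ + ((3−√5)/2)ⁿ − 2. -/
open SimpleGraph Polynomial Real

/-- The number of spanning trees of `G`. -/
noncomputable def numSpanningTrees {V : Type*} (G : SimpleGraph V) : ℕ :=
  Nat.card {H : SimpleGraph V // H ≤ G ∧ H.IsTree}

/-- The wheel graph `W(n)`: the cone over the cycle graph `Cₙ`. -/
def wheel (n : ℕ) : SimpleGraph (Option (Fin n)) := cone (cycleGraph n)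


/-- `f` is a parent function with root `r`. -/
def Rooted {V : Type*} (r : V) (f : V → V) : Prop :=
  f r = r ∧ ∀ x, ∃ k : ℕ, f^[k] x = r

/-- The graph of a parent function. -/
def parentGraph {V : Type*} (f : V → V) : SimpleGraph V :=
  SimpleGraph.fromRel (fun x y => f x = y)

lemma parentGraph_adj {V : Type*} (f : V → V) (x y : V) :
    (parentGraph f).Adj x y ↔ x ≠ y ∧ (f x = y ∨ f y = x) := by
  simp [parentGraph, SimpleGraph.fromRel_adj]

lemma two_cycle {V : Type*} {r x : V} {f : V → V} (hf : Rooted r f) (h : f (f x) = x) :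
    x = r := by
  obtain ⟨h0, h1⟩ := hf
  obtain ⟨k, hk⟩ := h1 x
  have key : ∀ k : ℕ, f^[k] x = x ∨ f^[k] x = f x := by
    intro k
    induction k with
    | zero => left; rfl
    | succ k ih =>
      rw [Function.iterate_succ_apply']
      rcases ih with ih | ih <;> rw [ih]
      · right; rfl
      · left; exact h
  rcases key k with h2 | h2
  · rw [← h2, hk]
  · rw [hk] at h2
    rw [← h, ← h2, h0]

lemma parentGraph_inj {V : Type*} {r : V} {f g : V → V} (hf : Rooted r f) (hg : Rooted r g)
    (h : parentGraph f = parentGraph g) : f = g := by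
  have key : ∀ k : ℕ, ∀ x, f^[k] x = r → f x = g x := by
    intro k
    induction k with
    | zero => intro x hx; simp at hx; subst hx; rw [hf.1, hg.1]
    | succ k ih =>
      intro x hx
      rw [Function.iterate_succ_apply] at hx
      have h1 := ih _ hx
      by_contra hne
      have hxr : x ≠ r := by
        rintro rfl
        exact hne (by rw [hf.1, hg.1])
      have hxf : x ≠ f x := fun h2 => hxr (two_cycle hf (by rw [← h2, ← h2]))
      have ha : (parentGraph g).Adj x (f x) := by
        rw [← h, parentGraph_adj]; exact ⟨hxf, Or.inl rfl⟩
      rw [parentGraph_adj] at ha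
      rcases ha.2 with h2 | h2
      · exact hne h2.symm
      · exact hxr (two_cycle hf (h1.trans h2))
  funext x
  obtain ⟨k, hk⟩ := hf.2 x
  exact key k x hk

lemma parentGraph_isTree {V : Type*} [Finite V] {r : V} {f : V → V} (hf : Rooted r f) :
    (parentGraph f).IsTree := by
  classical
  have := Fintype.ofFinite V
  have hconn : (parentGraph f).Connected := by
    have hr : ∀ k : ℕ, ∀ x, f^[k] x = r → (parentGraph f).Reachable x r := by
      intro k
      induction k with
      | zero => intro x hx; simp at hx; subst hx; exact Reachable.refl _
      | succ k ih =>
        intro x hx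
        rw [Function.iterate_succ_apply] at hx
        by_cases hxf : x = f x
        · have := ih _ hx
          rwa [← hxf] at this
        · refine Reachable.trans (SimpleGraph.Adj.reachable ?_) (ih _ hx)
          rw [parentGraph_adj]; exact ⟨hxf, Or.inl rfl⟩
    have hr' : ∀ x, (parentGraph f).Reachable x r := fun x => by
      obtain ⟨k, hk⟩ := hf.2 x
      exact hr k x hk
    have : Nonempty V := ⟨r⟩
    exact ⟨fun x y => (hr' x).trans (hr' y).symm⟩
  rw [isTree_iff_connected_and_card]
  refine ⟨hconn, le_antisymm ?_ hconn.card_vert_le_card_edgeSet_add_one⟩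
  have hsub : (parentGraph f).edgeFinset ⊆ (Finset.univ.erase r).image (fun x => s(x, f x)) := by
    intro e
    induction e with
    | h x y =>
      rw [SimpleGraph.mem_edgeFinset, SimpleGraph.mem_edgeSet, parentGraph_adj]
      rintro ⟨hne, h⟩
      rw [Finset.mem_image]
      rcases h with h | h
      · refine ⟨x, ?_, by rw [h]⟩
        simp only [Finset.mem_erase, Finset.mem_univ, and_true]
        rintro rfl
        exact hne (by rw [← h, hf.1])
      · refine ⟨y, ?_, by rw [h, Sym2.eq_swap]⟩
        simp only [Finset.mem_erase, Finset.mem_univ, and_true]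
        rintro rfl
        exact hne (by rw [← h, hf.1])
  have h1 := (Finset.card_le_card hsub).trans Finset.card_image_le
  rw [Finset.card_erase_of_mem (Finset.mem_univ r), Finset.card_univ] at h1
  have hpos : 0 < Fintype.card V := Fintype.card_pos_iff.mpr ⟨r⟩
  rw [Nat.card_eq_fintype_card, Nat.card_eq_fintype_card, ← SimpleGraph.edgeFinset_card]
  omega

lemma exists_parent {V : Type*} [Finite V] (r : V) {T : SimpleGraph V} (hT : T.IsTree) :
    ∃ f, Rooted r f ∧ parentGraph f = T := by
  classical
  have := Fintype.ofFinite V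
  have hc := hT.connected
  have hex : ∀ x, ∃ y, (x = r → y = r) ∧ (x ≠ r → T.Adj x y ∧ T.dist y r + 1 = T.dist x r) := by
    intro x
    by_cases hx : x = r
    · exact ⟨r, fun _ => rfl, fun h => absurd hx h⟩
    · obtain ⟨p, hp⟩ := hc.exists_walk_length_eq_dist x r
      cases p with
      | nil => exact absurd rfl hx
      | @cons _ y _ h q =>
        refine ⟨y, fun h => absurd h hx, fun _ => ⟨h, ?_⟩⟩
        rw [Walk.length_cons] at hp
        have h1 := dist_le q
        have h2 : T.dist x r ≤ T.dist x y + T.dist y r := hc.dist_triangle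
        rw [SimpleGraph.dist_eq_one_iff_adj.mpr h] at h2
        omega
  choose f h0 h1 using hex
  have hf : Rooted r f := by
    refine ⟨h0 r rfl, ?_⟩
    have : ∀ d : ℕ, ∀ x, T.dist x r = d → ∃ k : ℕ, f^[k] x = r := by
      intro d
      induction d with
      | zero => intro x hx; exact ⟨0, (hc.dist_eq_zero_iff).mp hx⟩
      | succ d ih =>
        intro x hx
        have hxr : x ≠ r := by
          rintro rfl
          simp at hx
        obtain ⟨k, hk⟩ := ih (f x) (by have := (h1 x hxr).2; omega)
        exact ⟨k + 1, hk⟩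
    exact fun x => this _ x rfl
  refine ⟨f, hf, ?_⟩
  have hle : parentGraph f ≤ T := by
    intro x y h
    rw [parentGraph_adj] at h
    obtain ⟨hne, h | h⟩ := h
    · have : x ≠ r := fun hx => hne (by rw [← h, h0 x hx, hx])
      rw [← h]; exact (h1 x this).1
    · have : y ≠ r := fun hx => hne (by rw [← h, h0 y hx, hx])
      rw [← h]; exact (h1 y this).1.symm
  have e1 := (parentGraph_isTree hf).card_edgeFinset
  have e2 := hT.card_edgeFinset
  apply SimpleGraph.edgeFinset_inj.mp
  exact Finset.eq_of_subset_of_card_le (SimpleGraph.edgeFinset_mono hle) (by omega)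

/-- The transfer matrix. -/
def transfer : Matrix (Fin 3) (Fin 3) ℝ := fun a b => if a = 1 ∧ b = 2 then 0 else 1

lemma pow_walk {σ : Type*} [Fintype σ] [DecidableEq σ] (M : Matrix σ σ ℝ) (n : ℕ) :
    ∀ a b, (M ^ (n + 1)) a b = ∑ w : Fin n → σ, ∏ i : Fin (n + 1),
      M ((Fin.cons a w : Fin (n + 1) → σ) i) ((Fin.snoc w b : Fin (n + 1) → σ) i) := by
  induction n with
  | zero => intro a b; simp [Fin.snoc]
  | succ n ih =>
    intro a b
    rw [pow_succ', Matrix.mul_apply, ← (Fin.consEquiv (fun _ : Fin (n + 1) => σ)).sum_comp,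
      Fintype.sum_prod_type]
    refine Finset.sum_congr rfl fun c _ => ?_
    rw [ih, Finset.mul_sum]
    refine Finset.sum_congr rfl fun w _ => ?_
    rw [Fin.prod_univ_succ]
    simp only [Fin.consEquiv_apply, Fin.cons_succ, Fin.cons_zero, Fin.consEquiv, Equiv.coe_fn_mk]
    rw [← Fin.cons_snoc_eq_snoc_cons, Fin.prod_univ_succ]
    simp [Fin.prod_univ_succ]

lemma trace_walk {σ : Type*} [Fintype σ] [DecidableEq σ] (M : Matrix σ σ ℝ) (n : ℕ) :
    (M ^ (n + 1)).trace = ∑ w : Fin (n + 1) → σ, ∏ i : Fin (n + 1), M (w i) (w (i + 1)) := by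
  rw [← (Fin.consEquiv (fun _ : Fin (n + 1) => σ)).sum_comp, Fintype.sum_prod_type]
  simp only [Matrix.trace, Matrix.diag]
  refine Finset.sum_congr rfl fun c _ => ?_
  rw [pow_walk]
  refine Finset.sum_congr rfl fun w _ => Finset.prod_congr rfl fun i _ => ?_
  simp only [Fin.consEquiv_apply]
  congr 1
  refine Fin.lastCases ?_ (fun j => ?_) i
  · simp
  · rw [Fin.snoc_castSucc, Fin.coeSucc_eq_succ, Fin.cons_succ]

lemma trace_formula (n : ℕ) : (transfer ^ (n + 1)).trace =
    ((3 + Real.sqrt 5) / 2) ^ (n + 1) + ((3 - Real.sqrt 5) / 2) ^ (n + 1) := by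
  have h5 : Real.sqrt 5 ^ 2 = 5 := Real.sq_sqrt (by norm_num)
  have hM : transfer ^ 3 = (3 : ℝ) • transfer ^ 2 - transfer := by
    ext i j
    fin_cases i <;> fin_cases j <;>
      simp [transfer, pow_succ, Matrix.mul_apply, Fin.sum_univ_three] <;> norm_num
  induction n using Nat.twoStepInduction with
  | zero => simp [Matrix.trace, transfer, Fin.sum_univ_three]; ring
  | one =>
    simp [Matrix.trace, transfer, Fin.sum_univ_three, pow_two, Matrix.mul_apply]
    nlinarith
  | more n h1 h2 =>
    have : transfer ^ (n + 2 + 1) = (3 : ℝ) • transfer ^ (n + 1 + 1) - transfer ^ (n + 1) := by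
      rw [show n + 2 + 1 = n + 3 by ring, pow_add, hM, mul_sub, mul_smul_comm, ← pow_add,
        ← pow_succ]
    rw [this, Matrix.trace_sub, Matrix.trace_smul, h1, h2, smul_eq_mul]
    have ha : ((3 + Real.sqrt 5) / 2) ^ 2 = 3 * ((3 + Real.sqrt 5) / 2) - 1 := by nlinarith
    have hb : ((3 - Real.sqrt 5) / 2) ^ 2 = 3 * ((3 - Real.sqrt 5) / 2) - 1 := by nlinarith
    generalize (3 + Real.sqrt 5) / 2 = a at *
    generalize (3 - Real.sqrt 5) / 2 = b at *
    rw [show a ^ (n + 2 + 1) = a ^ (n + 1) * a ^ 2 by ring,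
      show b ^ (n + 2 + 1) = b ^ (n + 1) * b ^ 2 by ring, ha, hb]
    ring

lemma cheb_formula (n : ℕ) : 2 * (Polynomial.Chebyshev.T ℝ (n : ℤ)).eval (3 / 2 : ℝ) =
    ((3 + Real.sqrt 5) / 2) ^ n + ((3 - Real.sqrt 5) / 2) ^ n := by
  have h5 : Real.sqrt 5 ^ 2 = 5 := Real.sq_sqrt (by norm_num)
  induction n using Nat.twoStepInduction with
  | zero => simp; norm_num
  | one => simp; ring
  | more n h1 h2 =>
    have ha : ((3 + Real.sqrt 5) / 2) ^ 2 = 3 * ((3 + Real.sqrt 5) / 2) - 1 := by nlinarith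
    have hb : ((3 - Real.sqrt 5) / 2) ^ 2 = 3 * ((3 - Real.sqrt 5) / 2) - 1 := by nlinarith
    push_cast at *
    rw [Polynomial.Chebyshev.T_add_two]
    simp only [Polynomial.eval_sub, Polynomial.eval_mul, Polynomial.eval_X, Polynomial.eval_ofNat]
    generalize (3 + Real.sqrt 5) / 2 = a at *
    generalize (3 - Real.sqrt 5) / 2 = b at *
    rw [pow_add a, pow_add b, ha, hb]
    rw [pow_succ, pow_succ] at h2
    linear_combination 3 * h2 - h1

/-- Parent function of a word: `0` is the hub, `1` the next rim vertex, `2` the previous one. -/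
def par {m : ℕ} (w : Fin (m + 3) → Fin 3) : Option (Fin (m + 3)) → Option (Fin (m + 3))
  | none => none
  | some i => if w i = 0 then none else if w i = 1 then some (i + 1) else some (i - 1)

/-- Cyclic words avoiding `1` followed by `2`. -/
def Cyc {m : ℕ} (w : Fin (m + 3) → Fin 3) : Prop := ∀ i, ¬ (w i = 1 ∧ w (i + 1) = 2)

/-- Words giving trees. -/
def Good {m : ℕ} (w : Fin (m + 3) → Fin 3) : Prop :=
  Cyc w ∧ w ≠ (fun _ => 1) ∧ w ≠ (fun _ => 2)

lemma cyc_ind {m : ℕ} (P : Fin (m + 1) → Prop) (i : Fin (m + 1)) (h : P i)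
    (hs : ∀ j, P j → P (j + 1)) (j : Fin (m + 1)) : P j := by
  have key : ∀ k : ℕ, P (i + k • 1) := by
    intro k
    induction k with
    | zero => simpa using h
    | succ k ih => rw [succ_nsmul, ← add_assoc]; exact hs _ ih
  have := key (j - i).val
  have e : (j - i).val • (1 : Fin (m + 1)) = j - i := by
    open Fin.CommRing in
    rw [nsmul_one]; exact Fin.cast_val_eq_self _
  rw [e] at this
  simpa using this

lemma cyc_ind' {m : ℕ} (P : Fin (m + 1) → Prop) (i : Fin (m + 1)) (h : P i)
    (hs : ∀ j, P j → P (j - 1)) (j : Fin (m + 1)) : P j := by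
  have := cyc_ind (fun j => P (-j)) (-i) (by simpa using h)
    (fun j hj => by rw [neg_add, ← sub_eq_add_neg]; exact hs _ hj) (-j)
  simpa using this

lemma rooted_of_good {m : ℕ} {w : Fin (m + 3) → Fin 3} (h : Good w) : Rooted none (par w) := by
  refine ⟨rfl, ?_⟩
  rintro (_ | i)
  · exact ⟨0, rfl⟩
  by_contra hi
  obtain ⟨hc, h1, h2⟩ := h
  have step : ∀ x, (¬ ∃ k : ℕ, (par w)^[k] x = none) → ¬ ∃ k : ℕ, (par w)^[k] (par w x) = none :=
    fun x hx ⟨k, hk⟩ => hx ⟨k + 1, hk⟩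
  have hne0 : ∀ i, (¬ ∃ k : ℕ, (par w)^[k] (some i) = none) → w i ≠ 0 :=
    fun i hx h0 => hx ⟨1, by simp [par, h0]⟩
  have c3 : ∀ a : Fin 3, a ≠ 0 → a = 1 ∨ a = 2 := by decide
  rcases c3 _ (hne0 i hi) with hw | hw
  · apply h1
    funext j
    refine (cyc_ind (fun j => w j = 1 ∧ ¬ ∃ k : ℕ, (par w)^[k] (some j) = none) i ⟨hw, hi⟩ ?_ j).1
    rintro j ⟨hj, hj'⟩
    have s := step _ hj'
    have e : par w (some j) = some (j + 1) := by simp [par, hj]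
    rw [e] at s
    refine ⟨?_, s⟩
    rcases c3 _ (hne0 _ s) with h | h
    · exact h
    · exact absurd ⟨hj, h⟩ (hc j)
  · apply h2
    funext j
    refine (cyc_ind' (fun j => w j = 2 ∧ ¬ ∃ k : ℕ, (par w)^[k] (some j) = none) i ⟨hw, hi⟩ ?_ j).1
    rintro j ⟨hj, hj'⟩
    have s := step _ hj'
    have e : par w (some j) = some (j - 1) := by simp [par, hj]
    rw [e] at s
    refine ⟨?_, s⟩
    rcases c3 _ (hne0 _ s) with h | h
    · exact absurd ⟨h, by simpa using hj⟩ (hc (j - 1))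
    · exact h

lemma good_of_rooted {m : ℕ} {w : Fin (m + 3) → Fin 3} (h : Rooted none (par w)) : Good w := by
  have key : (∀ i, w i ≠ 0) → False := by
    intro hw
    obtain ⟨k, hk⟩ := h.2 (some 0)
    have : ∀ k : ℕ, ∃ j, (par w)^[k] (some 0) = some j := by
      intro k
      induction k with
      | zero => exact ⟨0, rfl⟩
      | succ k ih =>
        obtain ⟨j, hj⟩ := ih
        rw [Function.iterate_succ_apply', hj]
        simp only [par, hw j, if_false]
        split_ifs
        · exact ⟨_, rfl⟩
        · exact ⟨_, rfl⟩
    obtain ⟨j, hj⟩ := this k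
    rw [hk] at hj
    cases hj
  refine ⟨?_, ?_, ?_⟩
  · rintro i ⟨h1, h2⟩
    have : some i = (none : Option (Fin (m + 3))) := two_cycle h (by simp [par, h1, h2])
    cases this
  · rintro rfl
    exact key (fun _ => by simp)
  · rintro rfl
    exact key (fun _ => by simp)

lemma add_one_ne_sub_one {m : ℕ} (i : Fin (m + 3)) : i + 1 ≠ i - 1 := by
  intro h
  have h2 : (1 : Fin (m + 3)) + 1 = 0 := by
    have h3 : i + (1 + 1) = i + 0 := by
      rw [← add_assoc, h]; simp
    exact add_left_cancel h3
  have h4 := congrArg Fin.val h2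
  rw [Fin.val_add] at h4
  simp at h4
  rw [Nat.mod_eq_of_lt (by omega)] at h4
  omega

lemma par_inj {m : ℕ} {w v : Fin (m + 3) → Fin 3} (h : par w = par v) : w = v := by
  funext i
  have h1 := congrFun h (some i)
  have h2 := add_one_ne_sub_one i
  simp only [par] at h1
  have c : ∀ a b : Fin 3, (a = 0 ↔ b = 0) → (a = 1 ↔ b = 1) → a = b := by decide
  apply c
  · split_ifs at h1 <;> simp_all
  · split_ifs at h1 <;> simp_all [eq_comm]

lemma wheel_adj_some {m : ℕ} (i : Fin (m + 3)) (y : Option (Fin (m + 3))) :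
    (wheel (m + 3)).Adj (some i) y ↔ y = none ∨ y = some (i + 1) ∨ y = some (i - 1) := by
  have hone : (1 : Fin (m + 3)) ≠ 0 := by simp
  cases y with
  | none => simp [wheel, cone]
  | some j =>
    simp only [wheel, cone, SimpleGraph.fromRel_adj]
    have := @SimpleGraph.cycleGraph_adj (m + 1)
    simp only [this, Option.some.injEq, reduceCtorEq, false_or, ne_eq]
    constructor
    · rintro ⟨-, ⟨a, b, rfl, rfl, h | h⟩ | ⟨a, b, rfl, rfl, h | h⟩⟩
      · right; rw [← h]; abel
      · left; rw [← h]; abel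
      · left; rw [← h]; abel
      · right; rw [← h]; abel
    · rintro (rfl | rfl)
      · exact ⟨by simp, Or.inl ⟨_, _, rfl, rfl, by right; abel⟩⟩
      · refine ⟨fun h => hone ?_, Or.inl ⟨_, _, rfl, rfl, by left; abel⟩⟩
        exact sub_eq_self.mp h.symm

lemma par_le {m : ℕ} (w : Fin (m + 3) → Fin 3) : parentGraph (par w) ≤ wheel (m + 3) := by
  have key : ∀ x y, x ≠ y → par w x = y → (wheel (m + 3)).Adj x y := by
    intro x y hne h
    cases x with
    | none => exact absurd h hne
    | some i =>
      rw [wheel_adj_some, ← h]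
      simp only [par]
      split_ifs <;> simp
  intro x y h
  rw [parentGraph_adj] at h
  rcases h with ⟨hne, h | h⟩
  · exact key _ _ hne h
  · exact (key _ _ hne.symm h).symm

lemma exists_word {m : ℕ} {f : Option (Fin (m + 3)) → Option (Fin (m + 3))} (hf : Rooted none f)
    (hle : parentGraph f ≤ wheel (m + 3)) : ∃ w, f = par w := by
  have : ∀ i, ∃ a : Fin 3, f (some i) =
      if a = 0 then none else if a = 1 then some (i + 1) else some (i - 1) := by
    intro i
    have hne : some i ≠ f (some i) := fun h => by
      have := two_cycle hf (x := some i) (by rw [← h, ← h])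
      cases this
    have ha : (parentGraph f).Adj (some i) (f (some i)) := by
      rw [parentGraph_adj]; exact ⟨hne, Or.inl rfl⟩
    rcases (wheel_adj_some _ _).mp (hle ha) with h | h | h
    · exact ⟨0, by simp [h]⟩
    · exact ⟨1, by simp [h]⟩
    · exact ⟨2, by simp [h]⟩
  choose w hw using this
  refine ⟨w, ?_⟩
  funext x
  cases x with
  | none => exact hf.1
  | some i => exact hw i

lemma card_trees (m : ℕ) : numSpanningTrees (wheel (m + 3)) =
    Nat.card {w : Fin (m + 3) → Fin 3 // Good w} := by
  symm
  refine Nat.card_congr (Equiv.ofBijective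
    (fun w => ⟨parentGraph (par w.1), par_le _, parentGraph_isTree (rooted_of_good w.2)⟩) ⟨?_, ?_⟩)
  · rintro ⟨w, hw⟩ ⟨v, hv⟩ h
    simp only [Subtype.mk.injEq] at h
    exact Subtype.ext (par_inj (parentGraph_inj (rooted_of_good hw) (rooted_of_good hv) h))
  · rintro ⟨T, hle, hT⟩
    obtain ⟨f, hf, rfl⟩ := exists_parent none hT
    obtain ⟨w, rfl⟩ := exists_word hf hle
    exact ⟨⟨w, good_of_rooted hf⟩, rfl⟩

lemma card_good (m : ℕ) : (Nat.card {w : Fin (m + 3) → Fin 3 // Good w} : ℝ) =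
    (transfer ^ (m + 3)).trace - 2 := by
  classical
  rw [trace_walk transfer (m + 2)]
  have h1 : ∀ w : Fin (m + 3) → Fin 3,
      ∏ i, transfer (w i) (w (i + 1)) = if Cyc w then (1 : ℝ) else 0 := by
    intro w
    split_ifs with h
    · exact Finset.prod_eq_one fun i _ => if_neg (h i)
    · simp only [Cyc, not_forall, not_not] at h
      obtain ⟨i, hi⟩ := h
      exact Finset.prod_eq_zero (Finset.mem_univ i) (if_pos hi)
  rw [Finset.sum_congr rfl (fun w _ => h1 w), Finset.sum_boole]
  rw [Nat.card_eq_fintype_card, Fintype.card_subtype]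
  have hne : (fun _ => 1 : Fin (m + 3) → Fin 3) ≠ (fun _ => 2) := fun h => by
    have := congrFun h 0
    revert this
    decide
  have e : (Finset.univ.filter (fun w : Fin (m + 3) → Fin 3 => Cyc w)) =
      insert (fun _ => 1) (insert (fun _ => 2) (Finset.univ.filter (fun w => Good w))) := by
    ext w
    simp only [Finset.mem_filter, Finset.mem_univ, true_and, Finset.mem_insert]
    constructor
    · intro h
      by_cases h1 : w = fun _ => 1
      · exact Or.inl h1
      by_cases h2 : w = fun _ => 2
      · exact Or.inr (Or.inl h2)
      exact Or.inr (Or.inr ⟨h, h1, h2⟩)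
    · rintro (rfl | rfl | h)
      · rintro i ⟨-, h⟩
        simp at h
      · rintro i ⟨h, -⟩
        simp at h
      · exact h.1
  rw [e, Finset.card_insert_of_notMem, Finset.card_insert_of_notMem]
  · push_cast; ring
  · simp only [Finset.mem_filter, Finset.mem_univ, true_and]
    exact fun h => h.2.2 rfl
  · simp only [Finset.mem_insert, Finset.mem_filter, Finset.mem_univ, true_and]
    rintro (h | h)
    · exact hne h
    · exact h.2.1 rfl

theorem numSpanningTrees_wheel (n : ℕ) (hn : 3 ≤ n) :
    (numSpanningTrees (wheel n) : ℝ) =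
        2 * (Polynomial.Chebyshev.T ℝ (n : ℤ)).eval (3 / 2 : ℝ) - 2 ∧
    (numSpanningTrees (wheel n) : ℝ) =
        ((3 + Real.sqrt 5) / 2) ^ n + ((3 - Real.sqrt 5) / 2) ^ n - 2 := by
  rw [cheb_formula, and_self]
  obtain ⟨m, rfl⟩ : ∃ m, n = m + 3 := ⟨n - 3, by omega⟩
  rw [card_trees, card_good, trace_formula (m + 2)]
end

section
/- The number of rooted spanning forests of the cycle graph Cₙ equals 2Tₙ(3/2) − 2, where Tₙ is the Chebyshev polynomial of the first kind; equivalently it equals det(Iₙ + L(Cₙ)) = ((3+√5)/2)ⁿ + ((3−√5)/2)ⁿ − 2. -/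
open SimpleGraph Polynomial Real

/-- A rooted spanning forest of `G`: a spanning acyclic subgraph together with a set of
roots containing exactly one vertex of each connected component. -/
def RootedSpanningForest {V : Type*} (G : SimpleGraph V) : Type _ :=
  {p : SimpleGraph V × Set V // p.1 ≤ G ∧ p.1.IsAcyclic ∧
    ∀ c : p.1.ConnectedComponent, ∃! v, v ∈ p.2 ∧ p.1.connectedComponentMk v = c}

/-- The number of rooted spanning forests of `G`. -/
noncomputable def numRootedSpanningForests {V : Type*} (G : SimpleGraph V) : ℕ :=
  Nat.card (RootedSpanningForest G)

namespace RSF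

variable {V : Type*}

/-- Acyclic pointer functions on `G`: each vertex points to itself or a neighbour, and each
orbit reaches a fixed point. -/
def Ptr (G : SimpleGraph V) (f : V → V) : Prop :=
  (∀ v, f v = v ∨ G.Adj v (f v)) ∧ ∀ v, ∃ k, f (f^[k] v) = f^[k] v

/-- The graph of a pointer function. -/
def gr (f : V → V) : SimpleGraph V := SimpleGraph.fromRel (fun u v => f u = v)

lemma gr_adj (f : V → V) (u v : V) : (gr f).Adj u v ↔ u ≠ v ∧ (f u = v ∨ f v = u) := by
  simp [gr]

lemma reach_ind {G : SimpleGraph V} {S : V → V → Prop} (h0 : ∀ v, S v v)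
    (h1 : ∀ u v w, G.Adj u v → S v w → S u w) {u v : V} (h : G.Reachable u v) : S u v := by
  obtain ⟨p⟩ := h
  induction p with
  | nil => exact h0 _
  | cons ha _ ih => exact h1 _ _ _ ha ih

lemma iter_fixed {f : V → V} {v : V} (h : f v = v) (k : ℕ) : f^[k] v = v :=
  Function.iterate_fixed h k

lemma Ptr.no_period {G : SimpleGraph V} {f : V → V} (hf : Ptr G f) {v : V} {k : ℕ}
    (h : f^[k] (f v) = v) : f v = v := by
  obtain ⟨m, hm⟩ := hf.2 v
  have h1 : f^[k+1] v = v := by simpa [Function.iterate_succ_apply] using h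
  have h2 : f^[(k+1) * m] v = v := by
    rw [Function.iterate_mul]; exact iter_fixed h1 m
  have h3 : f^[(k+1) * m] v = f^[m] v := by
    have : (k+1) * m = k * m + m := by ring
    rw [this, Function.iterate_add_apply]
    exact iter_fixed hm _
  have : f^[m] v = v := by rw [← h3, h2]
  rw [this] at hm; exact hm

lemma gr_reach_step (f : V → V) (v : V) : (gr f).Reachable v (f v) := by
  by_cases h : v = f v
  · rw [← h]
  · exact SimpleGraph.Adj.reachable ((gr_adj _ _ _).2 ⟨h, Or.inl rfl⟩)

lemma gr_reach_iter (f : V → V) (v : V) (k : ℕ) : (gr f).Reachable v (f^[k] v) := by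
  induction k with
  | zero => exact SimpleGraph.Reachable.refl _
  | succ k ih =>
    rw [Function.iterate_succ_apply']
    exact ih.trans (gr_reach_step f _)

lemma gr_reach_join (f : V → V) {u v : V} (h : (gr f).Reachable u v) :
    ∃ k l, f^[k] u = f^[l] v := by
  refine reach_ind (S := fun u v => ∃ k l, f^[k] u = f^[l] v) (fun v => ⟨0, 0, rfl⟩) ?_ h
  rintro u v w ha ⟨k, l, hkl⟩
  rcases ((gr_adj _ _ _).1 ha).2 with h | h
  · exact ⟨k + 1, l, by rw [Function.iterate_succ_apply, h, hkl]⟩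
  · refine ⟨k, l + 1, ?_⟩
    rw [Function.iterate_succ_apply', ← hkl, ← h, ← Function.iterate_succ_apply,
      Function.iterate_succ_apply']

lemma gr_le {G : SimpleGraph V} {f : V → V} (hf : ∀ v, f v = v ∨ G.Adj v (f v)) : gr f ≤ G := by
  intro u v h
  obtain ⟨hne, h | h⟩ := (gr_adj _ _ _).1 h
  · rcases hf u with h' | h'
    · exact absurd (h'.symm.trans h) hne
    · rwa [h] at h'
  · rcases hf v with h' | h'
    · exact absurd (h.symm.trans h') hne
    · rw [h] at h'; exact h'.symm

lemma Ptr.bridge {G : SimpleGraph V} {f : V → V} (hf : Ptr G f) {v : V} (hne : f v ≠ v) :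
    ¬ ((gr f).deleteEdges {s(v, f v)}).Reachable v (f v) := by
  intro h
  have key : (∃ k, f^[k] (f v) = v) ↔ (∃ k, f^[k] v = v) := by
    refine (reach_ind (G := (gr f).deleteEdges {s(v, f v)})
      (S := fun a b => (∃ k, f^[k] a = v) ↔ (∃ k, f^[k] b = v)) (fun _ => Iff.rfl) ?_ h).symm
    have aux : ∀ a, a ≠ v → ((∃ k, f^[k] a = v) ↔ (∃ k, f^[k] (f a) = v)) := by
      intro a ha
      constructor
      · rintro ⟨k, hk⟩
        cases k with
        | zero => exact absurd hk ha
        | succ k => exact ⟨k, by rwa [Function.iterate_succ_apply] at hk⟩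
      · rintro ⟨k, hk⟩
        exact ⟨k + 1, by rwa [Function.iterate_succ_apply]⟩
    intro a b c hab hbc
    refine Iff.trans ?_ hbc
    rw [SimpleGraph.deleteEdges_adj, gr_adj] at hab
    obtain ⟨⟨hne', h | h⟩, hnot⟩ := hab
    · subst h
      apply aux
      rintro rfl
      simp at hnot
    · subst h
      refine (aux _ ?_).symm
      rintro rfl
      simp [Sym2.eq_swap] at hnot
  obtain ⟨k, hk⟩ := key.2 ⟨0, rfl⟩
  exact hne (hf.no_period hk)

lemma Ptr.acyclic {G : SimpleGraph V} {f : V → V} (hf : Ptr G f) : (gr f).IsAcyclic := by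
  rw [SimpleGraph.isAcyclic_iff_forall_adj_isBridge]
  intro u v h
  obtain ⟨hne, h | h⟩ := (gr_adj _ _ _).1 h
  · subst h
    exact hf.bridge hne.symm
  · subst h
    rw [Sym2.eq_swap]
    exact hf.bridge hne

lemma Ptr.existsUnique {G : SimpleGraph V} {f : V → V} (hf : Ptr G f)
    (c : (gr f).ConnectedComponent) :
    ∃! v, v ∈ {v | f v = v} ∧ (gr f).connectedComponentMk v = c := by
  induction c using SimpleGraph.ConnectedComponent.ind with
  | h u =>
  obtain ⟨k, hk⟩ := hf.2 u
  refine ⟨f^[k] u, ⟨hk, ?_⟩, ?_⟩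
  · exact SimpleGraph.ConnectedComponent.sound (gr_reach_iter f u k).symm
  · rintro w ⟨hw, hwu⟩
    have h1 := SimpleGraph.ConnectedComponent.exact hwu
    obtain ⟨a, b, hab⟩ := gr_reach_join f (h1.trans (gr_reach_iter f u k))
    rwa [iter_fixed hw, iter_fixed hk] at hab

/-- The rooted forest of a pointer function. -/
def toForest (G : SimpleGraph V) (f : {f : V → V // Ptr G f}) : RootedSpanningForest G :=
  ⟨(gr f.1, {v | f.1 v = v}), gr_le f.2.1, f.2.acyclic, f.2.existsUnique⟩

lemma toForest_inj (G : SimpleGraph V) : Function.Injective (toForest G) := by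
  rintro ⟨f, hf⟩ ⟨g, hg⟩ h
  have h' := congrArg Subtype.val h
  simp only [toForest, Prod.mk.injEq] at h'
  obtain ⟨h1, h2⟩ := h'
  have hfix : ∀ v, f v = v ↔ g v = v := fun v => Set.ext_iff.1 h2 v
  apply Subtype.ext
  funext v
  by_contra hne
  have step : ∀ u, f u ≠ g u → f (f u) ≠ g (f u) := by
    intro u hu
    have hfu : f u ≠ u := fun e => hu (e.trans ((hfix u).1 e).symm)
    have hadj : (gr g).Adj u (f u) := by
      rw [← h1, gr_adj]; exact ⟨hfu.symm, Or.inl rfl⟩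
    rcases ((gr_adj _ _ _).1 hadj).2 with e | e
    · exact absurd e.symm hu
    · rw [e]
      intro e2
      exact hfu (hf.no_period (k := 1) e2)
  have all : ∀ k, f (f^[k] v) ≠ g (f^[k] v) := by
    intro k
    induction k with
    | zero => exact hne
    | succ k ih => rw [Function.iterate_succ_apply']; exact step _ ih
  obtain ⟨k, hk⟩ := hf.2 v
  exact all k (hk.trans ((hfix _).1 hk).symm)

lemma exists_closer {F : SimpleGraph V} {u r : V} (h : F.Reachable u r) (hne : u ≠ r) :
    ∃ w, F.Adj u w ∧ F.dist w r < F.dist u r := by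
  obtain ⟨p, hp⟩ := h.exists_walk_length_eq_dist
  cases p with
  | nil => exact absurd rfl hne
  | cons ha q =>
    refine ⟨_, ha, ?_⟩
    have := SimpleGraph.dist_le q
    simp at hp
    omega

lemma toForest_surj (G : SimpleGraph V) : Function.Surjective (toForest G) := by
  classical
  rintro ⟨⟨F, R⟩, hle, hac, hR⟩
  dsimp only at hle hac hR
  choose rt hrt using fun c => (hR c).exists
  have huniq : ∀ u v, u ∈ R → v ∈ R → F.Reachable u v → u = v := fun u v hu hv huv =>
    (hR (F.connectedComponentMk v)).unique ⟨hu, SimpleGraph.ConnectedComponent.sound huv⟩ ⟨hv, rfl⟩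
  have hreach : ∀ v, F.Reachable v (rt (F.connectedComponentMk v)) := fun v =>
    (SimpleGraph.ConnectedComponent.exact (hrt (F.connectedComponentMk v)).2).symm
  have hex : ∀ v, ∃ w, (v ∈ R → w = v) ∧ (v ∉ R → F.Adj v w ∧
      F.dist w (rt (F.connectedComponentMk v)) < F.dist v (rt (F.connectedComponentMk v))) := by
    intro v
    by_cases hv : v ∈ R
    · exact ⟨v, fun _ => rfl, fun h => absurd hv h⟩
    · obtain ⟨w, hw⟩ := exists_closer (hreach v) (fun e => hv (e ▸ (hrt _).1))
      exact ⟨w, fun h => absurd h hv, fun _ => hw⟩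
  choose f hf1 hf2 using hex
  have hF : Ptr F f := by
    constructor
    · intro v
      by_cases hv : v ∈ R
      · exact Or.inl (hf1 v hv)
      · exact Or.inr (hf2 v hv).1
    · have : ∀ d v, F.dist v (rt (F.connectedComponentMk v)) = d →
          ∃ k, f (f^[k] v) = f^[k] v := by
        intro d
        induction d using Nat.strong_induction_on with
        | _ d ih =>
        intro v hd
        by_cases hv : v ∈ R
        · exact ⟨0, hf1 v hv⟩
        · have h2 := hf2 v hv
          have e : F.connectedComponentMk (f v) = F.connectedComponentMk v :=
            SimpleGraph.ConnectedComponent.sound h2.1.symm.reachable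
          obtain ⟨k, hk⟩ := ih _ (by rw [← hd]; exact h2.2) (f v) (by rw [e])
          exact ⟨k + 1, by simpa only [Function.iterate_succ_apply] using hk⟩
      exact fun v => this _ v rfl
  have hfix : ∀ v, f v = v ↔ v ∈ R := by
    intro v
    refine ⟨fun h => ?_, hf1 v⟩
    by_contra hv
    exact (hf2 v hv).1.ne h.symm
  have hsub : gr f ≤ F := gr_le hF.1
  have hgr : gr f = F := by
    refine le_antisymm hsub ?_
    intro u v huv
    by_contra hnot
    have hb := SimpleGraph.isAcyclic_iff_forall_adj_isBridge.1 hac huv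
    rw [SimpleGraph.isBridge_iff] at hb
    apply hb
    have hle2 : gr f ≤ F.deleteEdges {s(u, v)} := by
      intro a b hab
      rw [SimpleGraph.deleteEdges_adj]
      refine ⟨hsub hab, ?_⟩
      intro hm
      rcases (Sym2.eq_iff.1 (Set.mem_singleton_iff.1 hm)) with ⟨rfl, rfl⟩ | ⟨rfl, rfl⟩
      · exact hnot hab
      · exact hnot hab.symm
    refine SimpleGraph.Reachable.mono hle2 ?_
    obtain ⟨k, hk⟩ := hF.2 u
    obtain ⟨l, hl⟩ := hF.2 v
    have e : f^[k] u = f^[l] v := by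
      apply huniq _ _ ((hfix _).1 hk) ((hfix _).1 hl)
      exact ((gr_reach_iter f u k).mono hsub).symm.trans
        (huv.reachable.trans ((gr_reach_iter f v l).mono hsub))
    exact (gr_reach_iter f u k).trans (e ▸ (gr_reach_iter f v l).symm)
  refine ⟨⟨f, fun v => (hF.1 v).imp id (fun h => hle h), hF.2⟩, ?_⟩
  apply Subtype.ext
  refine Prod.ext hgr ?_
  ext v
  exact hfix v

lemma num_eq (G : SimpleGraph V) :
    numRootedSpanningForests G = Nat.card {f : V → V // Ptr G f} :=
  (Nat.card_congr (Equiv.ofBijective _ ⟨toForest_inj G, toForest_surj G⟩)).symm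

end RSF

namespace RSF

/-- Cyclic shift matrix. -/
def shiftM (N : ℕ) [NeZero N] : Matrix (Fin N) (Fin N) ℝ :=
  Matrix.of fun i j => if i + 1 = j then 1 else 0

lemma det_shift (n : ℕ) (x : ℝ) :
    (x • (1 : Matrix (Fin (n+2)) (Fin (n+2)) ℝ) - shiftM (n+2)).det = x ^ (n+2) - 1 := by
  rw [Matrix.det_succ_column_zero, Fin.sum_univ_succ, Fin.sum_univ_castSucc]
  have h0 : ((x • (1 : Matrix (Fin (n+2)) (Fin (n+2)) ℝ) - shiftM (n+2)).submatrix
      (Fin.succAbove 0) Fin.succ).det = x ^ (n+1) := by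
    rw [Matrix.det_of_isUpperTriangular]
    · simp [shiftM, Matrix.one_apply]
    · intro i j hij
      have hij' : j < i := hij
      have h1 : i.succ ≠ j.succ := fun h => hij'.ne' (Fin.succ_injective _ h)
      have h2 : i.succ + 1 ≠ j.succ := by
        intro h
        rw [Fin.ext_iff, Fin.val_add_one] at h
        split_ifs at h <;> simp at h <;> omega
      simp [shiftM, Matrix.one_apply, hij'.ne', h2]
  have h1 : ((x • (1 : Matrix (Fin (n+2)) (Fin (n+2)) ℝ) - shiftM (n+2)).submatrix
      (Fin.succAbove (Fin.last (n+1))) Fin.succ).det = (-1) ^ (n+1) := by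
    rw [Matrix.det_of_isLowerTriangular]
    · simp [shiftM, Matrix.one_apply, Fin.ext_iff]
    · intro i j hij
      have hij' : i < j := hij
      have h1 : i.castSucc ≠ j.succ := by
        intro h
        rw [Fin.ext_iff] at h
        simp at h
        omega
      simp [shiftM, Matrix.one_apply, hij'.ne, h1]
  have hmid : ∀ i : Fin n, (x • (1 : Matrix (Fin (n+2)) (Fin (n+2)) ℝ) - shiftM (n+2))
      i.castSucc.succ 0 = 0 := by
    intro i
    have h2 : i.castSucc.succ + 1 ≠ 0 := by
      intro h
      rw [Fin.ext_iff, Fin.val_add_one] at h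
      split_ifs at h with h'
      · rw [Fin.ext_iff] at h'; simp at h'; omega
      · simp at h
    simp [shiftM, Matrix.one_apply, h2]
  have e0 : (x • (1 : Matrix (Fin (n+2)) (Fin (n+2)) ℝ) - shiftM (n+2)) 0 0 = x := by
    simp [shiftM]
  have e1 : (x • (1 : Matrix (Fin (n+2)) (Fin (n+2)) ℝ) - shiftM (n+2)) (Fin.last (n+1)) 0
      = -1 := by
    simp [shiftM, Matrix.one_apply]
  rw [Finset.sum_eq_zero (fun i _ => by rw [hmid]; ring), Fin.succ_last, e0, h0, e1, h1]
  simp only [Fin.val_zero, Fin.val_last, Nat.succ_eq_add_one]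
  have : ((-1 : ℝ) ^ (n+1)) * (-1) ^ (n+1) = 1 := by rw [← mul_pow]; simp
  linear_combination -this

lemma shift_mul_T (n : ℕ) : shiftM (n+2) * (shiftM (n+2)).transpose = 1 := by
  ext i j
  simp [Matrix.mul_apply, shiftM, Matrix.one_apply, eq_comm]

lemma lap_eq (m : ℕ) : (1 + lap (cycleGraph (m+3))).map (Int.cast : ℤ → ℝ) =
    (3 : ℝ) • 1 - shiftM (m+3) - (shiftM (m+3)).transpose := by
  classical
  ext i j
  have hd : ∀ inst, @SimpleGraph.degree _ (cycleGraph (m+3)) i inst = 2 := by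
    intro inst
    rw [← cycleGraph_degree_three_le (v := i)]
    congr!
  have h20 : (1 : Fin (m+3)) + 1 ≠ 0 := by
    intro h; rw [Fin.ext_iff] at h; simp [Fin.val_add] at h
    rw [Nat.mod_eq_of_lt (by omega)] at h; omega
  have h10 : (1 : Fin (m+3)) ≠ 0 := by simp
  simp only [lap, SimpleGraph.lapMatrix, SimpleGraph.degMatrix, Matrix.map_apply, Matrix.add_apply,
    Matrix.sub_apply, Matrix.diagonal_apply, Matrix.one_apply, SimpleGraph.adjMatrix_apply,
    Matrix.smul_apply, Matrix.transpose_apply, shiftM, Matrix.of_apply, cycleGraph_adj, hd]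
  by_cases hij : i = j
  · subst hij
    simp
  · by_cases h1 : i + 1 = j
    · subst h1
      have : i + 1 + 1 ≠ i := by simpa [add_assoc] using h20
      simp [this]
    · by_cases h2 : j + 1 = i
      · subst h2
        have : j + 1 + 1 ≠ j := by simpa [add_assoc] using h20
        simp [this]
      · have h3 : i - j ≠ 1 := fun h => h2 (by rw [← h]; abel)
        have h4 : j - i ≠ 1 := fun h => h1 (by rw [← h]; abel)
        simp [hij, h1, h2, h3, h4]

lemma det_lap (m : ℕ) {a b : ℝ} (hs : a + b = 3) (hp : a * b = 1) :
    (((1 + lap (cycleGraph (m+3))).det : ℤ) : ℝ) = a ^ (m+3) + b ^ (m+3) - 2 := by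
  have hb : b ≠ 0 := right_ne_zero_of_mul_eq_one hp
  have e : (((1 + lap (cycleGraph (m+3))).det : ℤ) : ℝ) =
      ((1 + lap (cycleGraph (m+3))).map (Int.cast : ℤ → ℝ)).det :=
    (Int.castRingHom ℝ).map_det _
  have f : (3 : ℝ) • (1 : Matrix (Fin (m+3)) (Fin (m+3)) ℝ) - shiftM (m+3)
      - (shiftM (m+3)).transpose =
      (a • 1 - shiftM (m+3)) * (b • (a • 1 - shiftM (m+3)).transpose) := by
    rw [Matrix.transpose_sub, Matrix.transpose_smul, Matrix.transpose_one, smul_sub, smul_smul,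
      mul_comm b a, hp, one_smul, sub_mul, mul_sub, mul_sub, mul_one, mul_one, mul_smul_comm, mul_smul_comm,
      shift_mul_T (m+1), smul_mul_assoc, one_mul, smul_smul, mul_comm b a, hp, one_smul, ← hs, add_smul]
    abel
  rw [e, lap_eq, f, Matrix.det_mul, Matrix.det_smul, Matrix.det_transpose, det_shift]
  have h1 : a ^ (m+1+2) * b ^ (m+3) = 1 := by rw [← mul_pow, hp, one_pow]
  simp only [Fintype.card_fin]
  linear_combination (a ^ (m+3) - 2) * h1

lemma sum_words {σ : Type*} [Fintype σ] [DecidableEq σ] (M : Matrix σ σ ℤ) (k : ℕ) :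
    ∀ A : σ → σ → ℤ, ∑ w : Fin (k+1) → σ, A (w 0) (w (Fin.last k)) *
      ∏ i : Fin k, M (w i.castSucc) (w i.succ) = ∑ a, ∑ b, A a b * (M ^ k) a b := by
  induction k with
  | zero =>
    intro A
    rw [← (Equiv.funUnique (Fin 1) σ).symm.sum_comp]
    simp [Matrix.one_apply, Equiv.funUnique]
  | succ k ih =>
    intro A
    rw [← (Fin.consEquiv (fun _ : Fin (k+2) => σ)).sum_comp, Fintype.sum_prod_type]
    refine Finset.sum_congr rfl fun a _ => ?_
    have := ih (fun c b => A a b * M a c)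
    calc _ = ∑ w : Fin (k+1) → σ, A a (w (Fin.last k)) * M a (w 0) *
          ∏ i : Fin k, M (w i.castSucc) (w i.succ) := by
          refine Finset.sum_congr rfl fun w _ => ?_
          rw [Fin.prod_univ_succ]
          simp [Fin.consEquiv, ← Fin.succ_last, ← Fin.succ_castSucc, mul_assoc]
      _ = _ := by
          rw [this, Finset.sum_comm]
          refine Finset.sum_congr rfl fun b _ => ?_
          rw [pow_succ', Matrix.mul_apply, Finset.mul_sum]
          exact Finset.sum_congr rfl fun c _ => by ring

/-- Transfer matrix. -/
def TM : Matrix (Fin 3) (Fin 3) ℤ := Matrix.of fun a b => if a = 1 ∧ b = 2 then 0 else 1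

/-- Words with no cyclic factor `1 2`. -/
def Valid {m : ℕ} (w : Fin (m+1) → Fin 3) : Prop := ∀ i, ¬ (w i = 1 ∧ w (i+1) = 2)

instance {m : ℕ} : DecidablePred (Valid (m := m)) := fun w => by unfold Valid; infer_instance

lemma card_valid (m : ℕ) :
    ((Finset.univ.filter (Valid (m := m))).card : ℤ) = (TM ^ (m+1)).trace := by
  have h := sum_words TM m (fun a b => TM b a)
  have h2 : (TM ^ (m+1)).trace = ∑ a, ∑ b, TM b a * (TM ^ m) a b := by
    rw [pow_succ, Matrix.trace]
    simp only [Matrix.diag, Matrix.mul_apply, mul_comm]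
  rw [h2, ← h, Finset.card_filter]
  push_cast
  refine Finset.sum_congr rfl fun w _ => ?_
  have h3 : (∏ i : Fin (m+1), TM (w i) (w (i+1))) = if Valid w then 1 else 0 := by
    split_ifs with hv
    · exact Finset.prod_eq_one fun i _ => by simp only [TM, Matrix.of_apply, if_neg (hv i)]
    · unfold Valid at hv
      push Not at hv
      obtain ⟨i, hi⟩ := hv
      exact Finset.prod_eq_zero (Finset.mem_univ i) (by simp only [TM, Matrix.of_apply, if_pos hi])
  rw [← h3, Fin.prod_univ_castSucc, mul_comm]
  simp [Fin.coeSucc_eq_succ]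

lemma trace_TM {a b : ℝ} (hs : a + b = 3) (hp : a * b = 1) (k : ℕ) :
    (((TM ^ (k+1)).trace : ℤ) : ℝ) = a ^ (k+1) + b ^ (k+1) := by
  have h3 : TM ^ 3 = 3 • TM ^ 2 - TM := by decide
  have key : (((TM ^ (k+1)).trace : ℤ) : ℝ) = a ^ (k+1) + b ^ (k+1) ∧
      (((TM ^ (k+2)).trace : ℤ) : ℝ) = a ^ (k+2) + b ^ (k+2) := by
    induction k with
    | zero =>
      have t1 : (TM ^ (0+1)).trace = 3 := by decide
      have t2 : (TM ^ (0+2)).trace = 7 := by decide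
      rw [t1, t2]
      push_cast
      constructor
      · linear_combination -hs
      · linear_combination (-(a + b) - 3) * hs + 2 * hp
    | succ k ih =>
      refine ⟨ih.2, ?_⟩
      have e : TM ^ (k+1+2) = 3 • TM ^ (k+2) - TM ^ (k+1) := by
        have : TM ^ (k+1+2) = TM ^ k * TM ^ 3 := by rw [← pow_add]
        rw [this, h3, mul_sub, mul_smul_comm, ← pow_add, ← pow_succ]
      rw [e, Matrix.trace_sub, Matrix.trace_smul]
      simp only [nsmul_eq_mul]
      push_cast
      rw [ih.1, ih.2]
      have hb : b = 3 - a := by linarith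
      have ha2 : a ^ 2 = 3 * a - 1 := by rw [hb] at hp; linarith
      have hb2 : b ^ 2 = 3 * b - 1 := by
        have : a = 3 - b := by linarith
        rw [this] at hp; linarith
      linear_combination (- a ^ (k+1)) * ha2 - b ^ (k+1) * hb2
  exact key.1

lemma cheb {a b : ℝ} (hs : a + b = 3) (hp : a * b = 1) (k : ℕ) :
    2 * (Polynomial.Chebyshev.T ℝ (k : ℤ)).eval (3 / 2 : ℝ) = a ^ k + b ^ k := by
  have key : 2 * (Polynomial.Chebyshev.T ℝ (k : ℤ)).eval (3 / 2 : ℝ) = a ^ k + b ^ k ∧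
    2 * (Polynomial.Chebyshev.T ℝ ((k + 1 : ℕ) : ℤ)).eval (3 / 2 : ℝ) = a ^ (k+1) + b ^ (k+1) := by
    induction k with
    | zero =>
      constructor
      · norm_num
      · simp; linarith
    | succ k ih =>
      refine ⟨ih.2, ?_⟩
      have e : (((k + 1 + 1 : ℕ)) : ℤ) = (k : ℤ) + 2 := by push_cast; ring
      have e' : (((k + 1 : ℕ)) : ℤ) = (k : ℤ) + 1 := by push_cast; ring
      rw [e, Polynomial.Chebyshev.T_add_two]
      have h2 := ih.2
      rw [e'] at h2
      simp only [Polynomial.eval_sub, Polynomial.eval_mul, Polynomial.eval_X,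
        Polynomial.eval_ofNat]
      have hb : b = 3 - a := by linarith
      have ha2 : a ^ 2 = 3 * a - 1 := by rw [hb] at hp; linarith
      have hb2 : b ^ 2 = 3 * b - 1 := by
        have : a = 3 - b := by linarith
        rw [this] at hp; linarith
      linear_combination 3 * h2 - ih.1 - a ^ k * ha2 - b ^ k * hb2
  exact key.1

end RSF

namespace RSF

/-- Steps. -/
def stp (m : ℕ) : Fin 3 → Fin (m+3) := ![0, 1, -1]

lemma one_ne_neg_one (m : ℕ) : (1 : Fin (m+3)) ≠ -1 := by
  intro h
  have h20 : (1 : Fin (m+3)) + 1 = 0 := by nth_rw 1 [h]; simp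
  rw [Fin.ext_iff] at h20; simp [Fin.val_add] at h20
  rw [Nat.mod_eq_of_lt (by omega)] at h20; omega

lemma stp_inj (m : ℕ) : Function.Injective (stp m) := by
  have h := one_ne_neg_one m
  intro a b hab
  fin_cases a <;> fin_cases b <;> simp_all [stp, eq_comm]

/-- Pointer function of a word. -/
def ptrOf {m : ℕ} (w : Fin (m+3) → Fin 3) : Fin (m+3) → Fin (m+3) := fun v => v + stp m (w v)

lemma ptrOf_fix {m : ℕ} (w : Fin (m+3) → Fin 3) (v : Fin (m+3)) : ptrOf w v = v ↔ w v = 0 := by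
  have : stp m 0 = 0 := rfl
  rw [ptrOf, add_eq_left, ← this, (stp_inj m).eq_iff]

/-- Good words. -/
def Good {m : ℕ} (w : Fin (m+3) → Fin 3) : Prop :=
  Valid w ∧ w ≠ (fun _ => 1) ∧ w ≠ (fun _ => 2)

lemma tri (x : Fin 3) : x = 0 ∨ x = 1 ∨ x = 2 := by fin_cases x <;> simp

open Fin.CommRing in
lemma ptr_of_good {m : ℕ} {w : Fin (m+3) → Fin 3} (h : Good w) :
    Ptr (cycleGraph (m+3)) (ptrOf w) := by
  obtain ⟨hv, h1, h2⟩ := h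
  constructor
  · intro v
    rcases tri (w v) with e | e | e
    · left; rw [ptrOf_fix, e]
    · right; rw [cycleGraph_adj]; simp [ptrOf, e, stp]
    · right; rw [cycleGraph_adj]; simp [ptrOf, e, stp]
  · intro v
    by_contra hno
    push Not at hno
    rcases tri (w v) with e | e | e
    · exact hno 0 ((ptrOf_fix w v).2 e)
    · apply h1
      have key : ∀ k : ℕ, (ptrOf w)^[k] v = v + (k : Fin (m+3)) ∧ w (v + (k : Fin (m+3))) = 1 := by
        intro k
        induction k with
        | zero => simp [e]
        | succ k ih =>
          have e1 : (ptrOf w)^[k+1] v = v + ((k+1 : ℕ) : Fin (m+3)) := by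
            rw [Function.iterate_succ_apply', ih.1, ptrOf, ih.2]
            simp [stp, add_assoc]
          refine ⟨e1, ?_⟩
          have hk := hno (k+1)
          rw [e1, ne_eq, ptrOf_fix] at hk
          have hv' := hv (v + (k : Fin (m+3)))
          rw [add_assoc, ← Nat.cast_add_one] at hv'
          rcases tri (w (v + ((k+1 : ℕ) : Fin (m+3)))) with t | t | t
          · exact absurd t hk
          · exact t
          · exact absurd ⟨ih.2, t⟩ hv'
      funext u
      have := (key (u - v).val).2
      simpa using this
    · apply h2
      have key : ∀ k : ℕ, (ptrOf w)^[k] v = v - (k : Fin (m+3)) ∧ w (v - (k : Fin (m+3))) = 2 := by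
        intro k
        induction k with
        | zero => simp [e]
        | succ k ih =>
          have e1 : (ptrOf w)^[k+1] v = v - ((k+1 : ℕ) : Fin (m+3)) := by
            rw [Function.iterate_succ_apply', ih.1, ptrOf, ih.2]
            simp [stp]
            abel
          refine ⟨e1, ?_⟩
          have hk := hno (k+1)
          rw [e1, ne_eq, ptrOf_fix] at hk
          have hv' := hv (v - ((k+1 : ℕ) : Fin (m+3)))
          have e2 : v - ((k+1 : ℕ) : Fin (m+3)) + 1 = v - k := by push_cast; abel
          rw [e2] at hv'
          rcases tri (w (v - ((k+1 : ℕ) : Fin (m+3)))) with t | t | t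
          · exact absurd t hk
          · exact absurd ⟨t, ih.2⟩ hv'
          · exact t
      funext u
      have := (key (v - u).val).2
      simpa using this

lemma card_good (m : ℕ) : Nat.card {f // Ptr (cycleGraph (m+3)) f} =
    Nat.card {w : Fin (m+3) → Fin 3 // Good w} := by
  symm
  refine Nat.card_congr (Equiv.ofBijective
    (fun w => ⟨ptrOf w.1, ptr_of_good w.2⟩) ⟨?_, ?_⟩)
  · rintro ⟨w, hw⟩ ⟨w', hw'⟩ h
    apply Subtype.ext
    funext v
    have := congrFun (congrArg Subtype.val h) v
    simp only [ptrOf, add_right_inj] at this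
    exact stp_inj m this
  · rintro ⟨f, hf⟩
    have hex : ∀ v, ∃ a, f v = v + stp m a := by
      intro v
      rcases hf.1 v with h | h
      · exact ⟨0, by simp [stp, h]⟩
      · rw [cycleGraph_adj] at h
        rcases h with h | h
        · exact ⟨2, by simp [stp, ← h]⟩
        · exact ⟨1, by simp [stp, ← h]⟩
    choose w hw using hex
    have hfw : ptrOf w = f := by funext v; rw [hw, ptrOf]
    have hz : ∃ v, w v = 0 := by
      obtain ⟨k, hk⟩ := hf.2 0
      rw [← hfw, ptrOf_fix] at hk
      exact ⟨_, hk⟩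
    obtain ⟨z, hz⟩ := hz
    refine ⟨⟨w, ?_, ?_, ?_⟩, Subtype.ext hfw⟩
    · rintro i ⟨h1, h2⟩
      have a1 : f i = i + 1 := by rw [hw, h1]; rfl
      have a2 : f (i + 1) = i := by rw [hw, h2]; simp [stp]
      have := hf.no_period (v := i) (k := 1) (by rw [a1]; exact a2)
      rw [← hfw, ptrOf_fix, h1] at this
      exact absurd this (by decide)
    · rintro rfl; revert hz; simp
    · rintro rfl; revert hz; simp

lemma card_good' (m : ℕ) : (Nat.card {w : Fin (m+3) → Fin 3 // Good w} : ℤ) =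
    (TM ^ (m+3)).trace - 2 := by
  classical
  rw [← card_valid (m+2), Nat.card_eq_fintype_card, Fintype.card_subtype]
  have e : Finset.univ.filter (Good (m := m)) =
      ((Finset.univ.filter (Valid (m := m+2))).erase (fun _ => 1)).erase (fun _ => 2) := by
    ext w
    simp only [Good, Finset.mem_filter, Finset.mem_univ, true_and, Finset.mem_erase]
    tauto
  have m1 : (fun _ => 1) ∈ Finset.univ.filter (Valid (m := m+2)) := by
    simp [Valid]
  have m2 : (fun _ => 2) ∈ (Finset.univ.filter (Valid (m := m+2))).erase (fun _ => 1) := by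
    simp only [Finset.mem_erase, Finset.mem_filter, Finset.mem_univ, true_and]
    refine ⟨fun h => absurd (congrFun h 0) (by decide), ?_⟩
    rintro i ⟨h, -⟩
    revert h; simp
  have c1 := Finset.card_erase_add_one m1
  have c2 := Finset.card_erase_add_one m2
  rw [e]
  omega

end RSF

theorem numRootedSpanningForests_cycle (n : ℕ) (hn : 3 ≤ n) :
    (numRootedSpanningForests (cycleGraph n) : ℤ) = (1 + lap (cycleGraph n)).det ∧
    (numRootedSpanningForests (cycleGraph n) : ℝ) =
        2 * (Polynomial.Chebyshev.T ℝ (n : ℤ)).eval (3 / 2 : ℝ) - 2 ∧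
    (numRootedSpanningForests (cycleGraph n) : ℝ) =
        ((3 + Real.sqrt 5) / 2) ^ n + ((3 - Real.sqrt 5) / 2) ^ n - 2 := by
  obtain ⟨m, rfl⟩ : ∃ m, n = m + 3 := ⟨n - 3, by omega⟩
  have h5 : Real.sqrt 5 * Real.sqrt 5 = 5 := Real.mul_self_sqrt (by norm_num)
  have hs : (3 + Real.sqrt 5) / 2 + (3 - Real.sqrt 5) / 2 = 3 := by ring
  have hp : (3 + Real.sqrt 5) / 2 * ((3 - Real.sqrt 5) / 2) = 1 := by
    linear_combination (-1 / 4) * h5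
  have hZ : (numRootedSpanningForests (cycleGraph (m+3)) : ℤ) = (RSF.TM ^ (m+3)).trace - 2 := by
    rw [RSF.num_eq, RSF.card_good, RSF.card_good']
  have hR : (numRootedSpanningForests (cycleGraph (m+3)) : ℝ) =
      ((3 + Real.sqrt 5) / 2) ^ (m+3) + ((3 - Real.sqrt 5) / 2) ^ (m+3) - 2 := by
    have := congrArg (Int.cast : ℤ → ℝ) hZ
    push_cast at this
    rw [this, RSF.trace_TM hs hp]
  refine ⟨?_, ?_, hR⟩
  · have h := RSF.det_lap m hs hp
    rw [← hR] at h
    exact_mod_cast h.symm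
  · rw [hR, RSF.cheb hs hp]
end

section
/- The Jacobian of the wheel graph W(n) is isomorphic to ℤ_{Fₙ} ⊕ ℤ_{5Fₙ} when n is even, and to ℤ_{Lₙ} ⊕ ℤ_{Lₙ} when n is odd, where Fₙ and Lₙ denote the n-th Fibonacci and Lucas numbers. -/
open SimpleGraph

/-- The Lucas numbers: `L₀ = 2`, `L₁ = 1`, `L_{n+2} = L_{n+1} + Lₙ`. -/
def lucas : ℕ → ℕ
  | 0 => 2
  | 1 => 1
  | n + 2 => lucas (n + 1) + lucas n


open scoped Fin.CommRing in
lemma lap_wheel_some (m : ℕ) [DecidableEq (Option (Fin (m+3)))] (x : Option (Fin (m+3)) → ℤ) (i : Fin (m+3)) :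
    Matrix.toLin' (lap (wheel (m+3))) x (some i)
      = 3 * x (some i) - x (some (i-1)) - x (some (i+1)) - x none := by
  classical
  have hnb : (wheel (m+3)).neighborFinset (some i) = {none, some (i-1), some (i+1)} := by
    ext v
    rw [SimpleGraph.mem_neighborFinset]
    unfold wheel cone
    cases v with
    | none => simp
    | some j =>
      simp only [SimpleGraph.fromRel_adj, SimpleGraph.cycleGraph_adj]
      simp only [ne_eq, Option.some.injEq, reduceCtorEq, false_or, Finset.mem_insert,
        Finset.mem_singleton]
      have h1 : (1 : Fin (m+3)) ≠ 0 := by simp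
      constructor
      · rintro ⟨_, ⟨a, b, rfl, rfl, h⟩ | ⟨a, b, rfl, rfl, h⟩⟩ <;> rcases h with h | h
        · left; rw [← h]; abel
        · right; rw [← h]; abel
        · right; rw [← h]; abel
        · left; rw [← h]; abel
      · rintro (rfl | rfl)
        · refine ⟨fun h => h1 ?_, Or.inl ⟨_, _, rfl, rfl, Or.inl (by abel)⟩⟩
          have := congrArg (fun t => i - t) h
          simpa using this.symm
        · refine ⟨fun h => h1 ?_, Or.inl ⟨_, _, rfl, rfl, Or.inr (by abel)⟩⟩
          have := congrArg (fun t => t - i) h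
          simpa using this.symm
  have hne : i - 1 ≠ i + 1 := by
    intro h
    have h2 : (1 : Fin (m+3)) + 1 = 0 := by
      have := congrArg (fun t => t - i + 1) h
      have h3 : i - 1 - i + 1 = 0 := by abel
      have h4 : i + 1 - i + 1 = 1 + 1 := by abel
      simp only [h3, h4] at this
      exact this.symm
    have := congrArg Fin.val h2
    rw [Fin.val_add] at this
    simp [Nat.mod_eq_of_lt] at this
  have hd : (wheel (m+3)).degree (some i) = 3 := by
    rw [← SimpleGraph.card_neighborFinset_eq_degree, hnb]
    rw [Finset.card_eq_three]
    exact ⟨_, _, _, by simp, by simp, by simpa using hne, rfl⟩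
  rw [Matrix.toLin'_apply]
  unfold lap
  have := SimpleGraph.lapMatrix_mulVec_apply (R := ℤ) (G := wheel (m+3)) (some i) x
  rw [hd, hnb, Finset.sum_insert (by simp), Finset.sum_insert (by simpa using hne),
    Finset.sum_singleton] at this
  refine Eq.trans ?_ (this.trans ?_)
  · congr!
  · push_cast; ring

lemma lap_wheel_none (m : ℕ) [DecidableEq (Option (Fin (m+3)))] (x : Option (Fin (m+3)) → ℤ) :
    Matrix.toLin' (lap (wheel (m+3))) x none
      = ((m + 3 : ℕ) : ℤ) * x none - ∑ i, x (some i) := by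
  classical
  have hnb : (wheel (m+3)).neighborFinset none = Finset.univ.map Function.Embedding.some := by
    ext v
    rw [SimpleGraph.mem_neighborFinset]
    unfold wheel cone
    cases v <;> simp
  have hd : (wheel (m+3)).degree none = m + 3 := by
    rw [← SimpleGraph.card_neighborFinset_eq_degree, hnb]
    simp
  rw [Matrix.toLin'_apply]
  unfold lap
  have := SimpleGraph.lapMatrix_mulVec_apply (R := ℤ) (G := wheel (m+3)) none x
  rw [hd, hnb, Finset.sum_map] at this
  refine Eq.trans ?_ (this.trans ?_)
  · congr!
  · rfl

open scoped Classical in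
/-- The image of an integer matrix, as used in `coker`. -/
noncomputable abbrev rng {α : Type*} [Fintype α] (M : Matrix α α ℤ) : Submodule ℤ (α → ℤ) :=
  LinearMap.range (Matrix.toLin' M)

/-- evaluation of a weighted sum -/
def wsum (m a : ℕ) (u : ℕ → ℤ) : (Option (Fin (m+3)) → ℤ) →+ ZMod a where
  toFun x := ∑ i : Fin (m+3), (x (some i) : ZMod a) * (u i.val : ZMod a)
  map_zero' := by simp
  map_add' x y := by simp [add_mul, Finset.sum_add_distrib]

open scoped Fin.CommRing in
lemma sum_shift {R : Type*} [CommRing R] (m : ℕ) (x U : Fin (m+3) → R) (h : R)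
    (hU : ∀ i, U (i+1) = 3 * U i - U (i-1)) :
    ∑ i, (3 * x i - x (i-1) - x (i+1) - h) * U i = 0 := by
  have e1 : ∀ (x U : Fin (m+3) → R), ∑ i, x (i-1) * U i = ∑ i, x i * U (i+1) := by
    intro x U
    rw [← Equiv.sum_comp (Equiv.addRight (1 : Fin (m+3)))]
    simp
  have e2 : ∀ (x U : Fin (m+3) → R), ∑ i, x (i+1) * U i = ∑ i, x i * U (i-1) := by
    intro x U
    rw [← Equiv.sum_comp (Equiv.subRight (1 : Fin (m+3)))]
    simp
  have e3 : ∀ (x : Fin (m+3) → R), ∑ i, (3 * x i - x (i-1) - x (i+1)) * U i = 0 := by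
    intro x
    simp only [sub_mul, Finset.sum_sub_distrib, e1, e2]
    rw [← Finset.sum_sub_distrib, ← Finset.sum_sub_distrib]
    apply Finset.sum_eq_zero
    intro i _
    rw [hU]; ring
  have e4 := e3 (fun _ => 1)
  have e5 := e3 x
  have : ∑ i, (3 * x i - x (i-1) - x (i+1) - h) * U i
    = ∑ i, (3 * x i - x (i-1) - x (i+1)) * U i - h * ∑ i, (3 * 1 - 1 - 1) * U i := by
    rw [Finset.mul_sum, ← Finset.sum_sub_distrib]
    apply Finset.sum_congr rfl
    intro i _
    ring
  rw [this, e4, e5]; simp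

lemma fin_cases_val (m : ℕ) (i : Fin (m+3)) :
    (i.val = m + 2 ∧ (i+1).val = 0) ∨ (i.val < m + 2 ∧ (i+1).val = i.val + 1) := by
  rw [Fin.val_add]
  have := i.2
  rcases Nat.lt_or_ge i.val (m+2) with h | h
  · right
    refine ⟨h, ?_⟩
    simp only [Fin.val_one]
    exact Nat.mod_eq_of_lt (by omega)
  · left
    have h' : i.val = m + 2 := by omega
    refine ⟨h', ?_⟩
    simp [h']

open scoped Fin.CommRing in
lemma periodic_rec (m a : ℕ) (u : ℕ → ℤ) (hu : ∀ k, u (k+2) = 3 * u (k+1) - u k)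
    (h0 : (u (m+3) : ZMod a) = u 0) (h1 : (u (m+4) : ZMod a) = u 1) (i : Fin (m+3)) :
    (u (i+1).val : ZMod a) = 3 * u i.val - u (i-1).val := by
  obtain ⟨j, rfl⟩ : ∃ j, i = j + 1 := ⟨i - 1, by simp⟩
  have hu' : ∀ k, (u (k+2) : ZMod a) = 3 * u (k+1) - u k := by
    intro k; rw [hu]; push_cast; ring
  rw [add_sub_cancel_right]
  rcases fin_cases_val m j with ⟨hj, hj1⟩ | ⟨hj, hj1⟩
  · rcases fin_cases_val m (j+1) with ⟨hk, hk1⟩ | ⟨hk, hk1⟩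
    · omega
    · rw [hk1, hj1, hj, ← h0]
      simp only [zero_add]
      rw [← h1]; exact hu' (m+2)
  · rcases fin_cases_val m (j+1) with ⟨hk, hk1⟩ | ⟨hk, hk1⟩
    · rw [hk1, hj1, ← h0, ← hu']
      congr 2; omega
    · rw [hk1, hj1]; exact hu' _

lemma wsum_lap (m a : ℕ) (u : ℕ → ℤ) (hu : ∀ k, u (k+2) = 3 * u (k+1) - u k)
    (h0 : (u (m+3) : ZMod a) = u 0) (h1 : (u (m+4) : ZMod a) = u 1)
    (x : Option (Fin (m+3)) → ℤ) [DecidableEq (Option (Fin (m+3)))] :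
    wsum m a u (Matrix.toLin' (lap (wheel (m+3))) x) = 0 := by
  have := sum_shift m (fun i => (x (some i) : ZMod a)) (fun i => (u i.val : ZMod a)) (x none)
    (periodic_rec m a u hu h0 h1)
  simp only [wsum, AddMonoidHom.coe_mk, ZeroHom.coe_mk, lap_wheel_some]
  push_cast
  exact this

open scoped Fin.CommRing in
lemma total_lap (m : ℕ) [DecidableEq (Option (Fin (m+3)))] (x : Option (Fin (m+3)) → ℤ) :
    ∑ v, Matrix.toLin' (lap (wheel (m+3))) x v = 0 := by
  rw [Fintype.sum_option, lap_wheel_none]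
  simp only [lap_wheel_some, Finset.sum_sub_distrib, ← Finset.mul_sum]
  have e1 : ∑ i : Fin (m+3), x (some (i-1)) = ∑ i, x (some i) :=
    Equiv.sum_comp (Equiv.subRight (1 : Fin (m+3))) (fun i => x (some i))
  have e2 : ∑ i : Fin (m+3), x (some (i+1)) = ∑ i, x (some i) :=
    Equiv.sum_comp (Equiv.addRight (1 : Fin (m+3))) (fun i => x (some i))
  rw [e1, e2]
  simp
  ring

open scoped Fin.CommRing in
lemma coker_rel (m : ℕ) (i : Fin (m+3)) :
    (Submodule.Quotient.mk (Pi.single (some (i+1)) 1 - Pi.single none 1) : coker (lap (wheel (m+3))))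
    = (3 : ℤ) • Submodule.Quotient.mk (Pi.single (some i) 1 - Pi.single none 1)
      - Submodule.Quotient.mk (Pi.single (some (i-1)) 1 - Pi.single none 1) := by
  rw [← Submodule.Quotient.mk_smul, ← Submodule.Quotient.mk_sub, Submodule.Quotient.eq]
  refine ⟨- Pi.single (some i) 1, ?_⟩
  rw [map_neg]
  ext v
  rw [Pi.neg_apply]
  cases v with
  | none =>
    rw [lap_wheel_none]
    simp [Pi.single_apply]
  | some j =>
    rw [lap_wheel_some]
    have a1 : (j - 1 = i) ↔ (j = i + 1) := sub_eq_iff_eq_add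
    have a2 : (j + 1 = i) ↔ (j = i - 1) := eq_sub_iff_add_eq.symm
    simp [Pi.single_apply, a1, a2]
    ring

open scoped Fin.CommRing in
lemma coker_vec (m : ℕ) (u w : ℕ → ℤ) (hu : ∀ k, u (k+2) = 3 * u (k+1) - u k)
    (hw : ∀ k, w (k+2) = 3 * w (k+1) - w k) (u0 : u 0 = 0) (u1 : u 1 = 1) (w0 : w 0 = 1) :
    ∃ f : ℕ → coker (lap (wheel (m+3))),
      (∀ i : Fin (m+3), f i.val = Submodule.Quotient.mk (Pi.single (some i) 1 - Pi.single none 1)) ∧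
      f (m+3) = f 0 ∧ f (m+4) = f 1 ∧ ∀ k, f k = w k • f 0 + u k • (f 1 - w 1 • f 0) := by
  let f : ℕ → coker (lap (wheel (m+3))) := fun k =>
    Submodule.Quotient.mk (Pi.single (some (k : Fin (m+3))) 1 - Pi.single none 1)
  have hf : ∀ k, f (k+2) = (3 : ℤ) • f (k+1) - f k := by
    intro k
    have := coker_rel m ((k+1 : ℕ) : Fin (m+3))
    have e1 : (((k+1 : ℕ) : Fin (m+3)) + 1) = ((k+2 : ℕ) : Fin (m+3)) := by push_cast; ring
    have e2 : (((k+1 : ℕ) : Fin (m+3)) - 1) = (k : Fin (m+3)) := by push_cast; ring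
    rw [e1, e2] at this
    exact this
  have hz : ((m + 3 : ℕ) : Fin (m+3)) = 0 := by
    apply Fin.ext
    simp
  refine ⟨f, ?_, ?_, ?_, ?_⟩
  · intro i
    simp [f]
  · simp only [f, hz, Nat.cast_zero]
  · have : ((m + 4 : ℕ) : Fin (m+3)) = ((1 : ℕ) : Fin (m+3)) := by
      rw [show m + 4 = (m+3) + 1 from rfl, Nat.cast_add (m+3) 1, hz, zero_add]
    simp only [f, this]
  · have key : ∀ k, f k = w k • f 0 + u k • (f 1 - w 1 • f 0) ∧
        f (k+1) = w (k+1) • f 0 + u (k+1) • (f 1 - w 1 • f 0) := by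
      intro k
      induction k with
      | zero => simp [u0, u1, w0]
      | succ k ih =>
        refine ⟨ih.2, ?_⟩
        rw [hf k, hu k, hw k]
        generalize f 1 - w 1 • f 0 = g at ih ⊢
        rw [ih.1, ih.2]
        module
    exact fun k => (key k).1

theorem jac_general (m a b : ℕ) (ha : a ≠ 0) (hb : b ≠ 0) (u w : ℕ → ℤ)
    (hu : ∀ k, u (k+2) = 3 * u (k+1) - u k)
    (hw : ∀ k, w (k+2) = 3 * w (k+1) - w k) (u0 : u 0 = 0) (u1 : u 1 = 1) (w0 : w 0 = 1)
    (α β γ δ : ℤ) (hα : w (m+3) = 1 + b * α) (hβ : u (m+3) = a * β)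
    (hγ : w (m+4) = w 1 + b * γ) (hδ : u (m+4) = 1 + a * δ) (hdet : α * δ - β * γ = -1) :
    Nonempty (jac (wheel (m+3)) ≃+ (ZMod a × ZMod b)) := by
  let tot : (Option (Fin (m+3)) → ℤ) →+ ℤ :=
    { toFun := fun x => ∑ v, x v
      map_zero' := by simp
      map_add' := fun x y => by simp [Finset.sum_add_distrib] }
  let φ : (Option (Fin (m+3)) → ℤ) →ₗ[ℤ] ℤ × (ZMod a × ZMod b) :=
    (tot.prod ((wsum m a u).prod (wsum m b w))).toIntLinearMap
  have hφ : ∀ x, φ x = (∑ v, x v, (wsum m a u x, wsum m b w x)) := fun x => rfl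
  obtain ⟨f, f1, f2, f3, f4⟩ := coker_vec m u w hu hw u0 u1 w0
  have hle : rng (lap (wheel (m+3))) ≤ LinearMap.ker φ := by
    rintro _ ⟨x, rfl⟩
    rw [LinearMap.mem_ker, hφ, total_lap, wsum_lap, wsum_lap]
    · rfl
    · exact hw
    · rw [hα, w0]; simp
    · rw [hγ]; simp
    · exact hu
    · rw [hβ, u0]; simp
    · rw [hδ, u1]; simp
  have hker : LinearMap.ker φ ≤ rng (lap (wheel (m+3))) := by
    intro x hx
    rw [LinearMap.mem_ker, hφ] at hx
    simp only [Prod.mk_eq_zero] at hx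
    obtain ⟨hx0, hxa, hxb⟩ := hx
    have ga : ((∑ i : Fin (m+3), x (some i) * u i.val : ℤ) : ZMod a) = 0 := by
      push_cast; exact hxa
    have gb : ((∑ i : Fin (m+3), x (some i) * w i.val : ℤ) : ZMod b) = 0 := by
      push_cast; exact hxb
    rw [ZMod.intCast_zmod_eq_zero_iff_dvd] at ga gb
    have hmk : (Submodule.Quotient.mk x : coker (lap (wheel (m+3)))) = 0 := by
      have hx : x = (∑ v, x v) • Pi.single none 1 +
          ∑ i : Fin (m+3), x (some i) • (Pi.single (some i) 1 - Pi.single none 1) := by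
        ext v
        cases v with
        | none => simp [Fintype.sum_option, Finset.sum_apply, Pi.single_apply]
        | some j => simp [Finset.sum_apply, Pi.single_apply]
      have e : (Submodule.Quotient.mk x : coker (lap (wheel (m+3))))
          = ∑ i : Fin (m+3), x (some i) • f i.val := by
        rw [hx0, zero_smul, zero_add] at hx
        simp only [f1]
        have := congrArg (Submodule.mkQ (rng (lap (wheel (m+3))))) hx
        rw [map_sum] at this
        simp only [map_smul] at this
        exact this
      have e2 : ∑ i : Fin (m+3), x (some i) • f i.val
          = (∑ i : Fin (m+3), x (some i) * w i.val) • f 0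
            + (∑ i : Fin (m+3), x (some i) * u i.val) • (f 1 - w 1 • f 0) := by
        rw [Finset.sum_smul, Finset.sum_smul, ← Finset.sum_add_distrib]
        apply Finset.sum_congr rfl
        intro i _
        rw [f4 i.val]
        generalize f 1 - w 1 • f 0 = g
        module
      have r0 := f4 (m+3)
      have r1 := f4 (m+4)
      rw [f2, hα, hβ] at r0
      rw [f3, hγ, hδ] at r1
      rw [e, e2]
      obtain ⟨s, hs⟩ := ga
      obtain ⟨t, ht⟩ := gb
      rw [hs, ht]
      generalize hg : f 1 - w 1 • f 0 = g at r0 r1 ⊢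
      have hf1 : f 1 = g + w 1 • f 0 := by rw [← hg]; abel
      rw [hf1] at r1
      have q0 : (b * α) • f 0 + (a * β) • g = 0 := by
        have := sub_eq_zero.2 r0.symm
        rw [← this]; module
      have q1 : (b * γ) • f 0 + (a * δ) • g = 0 := by
        have := sub_eq_zero.2 r1.symm
        rw [← this]; module
      have p0 : (b : ℤ) • f 0 = 0 := by
        have h1 : (b : ℤ) • f 0 = (-(b * (α * δ - β * γ))) • f 0 := by rw [hdet]; simp
        rw [h1]
        have h2 : (-(b * (α * δ - β * γ))) • f 0 =
          β • ((b * γ) • f 0 + (a * δ) • g) - δ • ((b * α) • f 0 + (a * β) • g) := by module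
        rw [h2, q0, q1]; simp
      have p1 : (a : ℤ) • g = 0 := by
        have h1 : (a : ℤ) • g = (-(a * (α * δ - β * γ))) • g := by rw [hdet]; simp
        rw [h1]
        have h2 : (-(a * (α * δ - β * γ))) • g =
          γ • ((b * α) • f 0 + (a * β) • g) - α • ((b * γ) • f 0 + (a * δ) • g) := by module
        rw [h2, q0, q1]; simp
      rw [mul_comm (b : ℤ), mul_comm (a : ℤ), mul_smul, mul_smul, p0, p1]
      simp
    exact (Submodule.Quotient.mk_eq_zero _).1 hmk
  have ws : ∀ (c : ℕ) (v : ℕ → ℤ) (i : Fin (m+3)),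
      wsum m c v (Pi.single (some i) 1) = v i.val := by
    intro c v i
    simp [wsum, Pi.single_apply]
  have wn : ∀ (c : ℕ) (v : ℕ → ℤ), wsum m c v (Pi.single none 1) = 0 := by
    intro c v
    simp [wsum, Pi.single_apply]
  have hsurj : Function.Surjective φ := by
    have s1 : φ (Pi.single none 1) = (1, (0, 0)) := by
      rw [hφ, wn, wn]; simp
    have s2 : φ (Pi.single (some 0) 1) = (1, (0, 1)) := by
      rw [hφ, ws, ws]; simp [u0, w0]
    have s3 : φ (Pi.single (some 1) 1) = (1, (1, (w 1 : ZMod b))) := by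
      rw [hφ, ws, ws]; simp [u1]
    rintro ⟨p, q, r⟩
    obtain ⟨q, rfl⟩ := ZMod.intCast_surjective q
    obtain ⟨r, rfl⟩ := ZMod.intCast_surjective r
    refine ⟨(p - r - q + q * w 1) • Pi.single none 1 + (r - q * w 1) • Pi.single (some 0) 1
      + q • Pi.single (some 1) 1, ?_⟩
    rw [map_add, map_add, map_smul, map_smul, map_smul, s1, s2, s3]
    simp
    ring
  have hk : rng (lap (wheel (m+3))) = LinearMap.ker φ := le_antisymm hle hker
  let e : coker (lap (wheel (m+3))) ≃ₗ[ℤ] ℤ × (ZMod a × ZMod b) :=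
    (Submodule.quotEquivOfEq _ _ hk).trans (φ.quotKerEquivOfSurjective hsurj)
  let ψ : jac (wheel (m+3)) →+ ZMod a × ZMod b :=
    { toFun := fun t => (e t.1).2
      map_zero' := by simp
      map_add' := fun x y => by simp }
  refine ⟨AddEquiv.ofBijective ψ ⟨?_, ?_⟩⟩
  · rw [injective_iff_map_eq_zero]
    rintro ⟨t, ht⟩ h
    have h2 : (e t).2 = 0 := h
    obtain ⟨c, hc⟩ := (Submodule.mem_torsion_iff t).1 ht
    have hc' : (c : ℤ) • t = 0 := hc
    have h3 : (c : ℤ) * (e t).1 = 0 := by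
      have := congrArg (fun z => (e z).1) hc'
      simpa using this
    have h1 : (e t).1 = 0 := by
      rcases mul_eq_zero.1 h3 with h | h
      · exact absurd h (nonZeroDivisors.coe_ne_zero c)
      · exact h
    have : e t = 0 := Prod.ext h1 h2
    apply Subtype.ext
    exact e.map_eq_zero_iff.1 this
  · rintro ⟨q, r⟩
    refine ⟨⟨e.symm (0, (q, r)), ?_⟩, ?_⟩
    · refine (Submodule.mem_torsion_iff _).2 ⟨⟨(a * b : ℤ), ?_⟩, ?_⟩
      · rw [mem_nonZeroDivisors_iff_ne_zero]
        positivity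
      · change (a * b : ℤ) • e.symm (0, (q, r)) = 0
        rw [← map_smul]
        simp
    · change (e (e.symm (0, (q, r)))).2 = _
      simp

lemma lucas_eq (n : ℕ) : (lucas n : ℤ) = 2 * Nat.fib (n+1) - Nat.fib n := by
  have : ∀ n, (lucas n : ℤ) = 2 * Nat.fib (n+1) - Nat.fib n ∧
      (lucas (n+1) : ℤ) = 2 * Nat.fib (n+2) - Nat.fib (n+1) := by
    intro n
    induction n with
    | zero => simp [lucas]
    | succ n ih =>
      refine ⟨ih.2, ?_⟩
      rw [lucas, Nat.cast_add, ih.1, ih.2, Nat.fib_add_two (n := n+1), Nat.fib_add_two (n := n)]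
      push_cast
      ring
  exact (this n).1

lemma fib_cassini (n : ℕ) : (Nat.fib (n+1) : ℤ)^2 - Nat.fib n * Nat.fib (n+1) - (Nat.fib n : ℤ)^2
    = (-1)^n := by
  induction n with
  | zero => simp
  | succ n ih =>
    rw [pow_succ (-1 : ℤ), ← ih, Nat.fib_add_two]
    push_cast
    ring

lemma fib_even (n : ℕ) : (Nat.fib (2*n) : ℤ) = Nat.fib n * (2 * Nat.fib (n+1) - Nat.fib n) := by
  have h := Nat.fib_two_mul n
  rw [h, Nat.cast_mul, Nat.cast_sub]
  · push_cast; ring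
  · have := Nat.fib_le_fib_succ (n := n); omega

lemma fib_odd (n : ℕ) : (Nat.fib (2*n+1) : ℤ) = (Nat.fib (n+1) : ℤ)^2 + (Nat.fib n : ℤ)^2 := by
  exact_mod_cast Nat.fib_two_mul_add_one n

lemma fib_step (k : ℕ) : (Nat.fib (2*(k+1)) : ℤ) = Nat.fib (2*k) + Nat.fib (2*k+1) ∧
    (Nat.fib (2*(k+1)+1) : ℤ) = Nat.fib (2*k) + 2 * Nat.fib (2*k+1) := by
  have h1 : Nat.fib (2*(k+1)) = Nat.fib (2*k) + Nat.fib (2*k+1) := Nat.fib_add_two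
  have h2 : Nat.fib (2*(k+1)+1) = Nat.fib (2*k+1) + Nat.fib (2*(k+1)) := Nat.fib_add_two
  rw [h2, h1]
  push_cast
  constructor <;> ring

theorem jac_wheel (n : ℕ) (hn : 3 ≤ n) :
    (Even n → Nonempty (jac (wheel n) ≃+ (ZMod (Nat.fib n) × ZMod (5 * Nat.fib n)))) ∧
    (Odd n → Nonempty (jac (wheel n) ≃+ (ZMod (lucas n) × ZMod (lucas n)))) := by
  obtain ⟨m, rfl⟩ : ∃ m, n = m + 3 := ⟨n - 3, by omega⟩
  have hpos : 0 < Nat.fib (m+3) := Nat.fib_pos.2 (by omega)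
  have hle : Nat.fib (m+3) ≤ Nat.fib (m+3+1) := Nat.fib_le_fib_succ
  have hc := fib_cassini (m+3)
  have hE := fib_even (m+3)
  have hO := fib_odd (m+3)
  have hL := lucas_eq (m+3)
  have hS := fib_step (m+3)
  have hF3 : Nat.fib 3 = 2 := rfl
  constructor
  · intro he
    rw [he.neg_one_pow] at hc
    refine jac_general m _ _ (by omega) (by omega) (fun k => Nat.fib (2*k))
      (fun k => Nat.fib (2*k+1) + 2 * Nat.fib (2*k)) ?_ ?_ (by simp) (by simp) (by simp)
      (Nat.fib (m+3+1)) (2 * Nat.fib (m+3+1) - Nat.fib (m+3))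
      (2 * Nat.fib (m+3+1) + Nat.fib (m+3)) (3 * Nat.fib (m+3+1) + Nat.fib (m+3)) ?_ ?_ ?_ ?_ ?_
    · intro k
      simp only [(fib_step (k+1)).1, (fib_step k).1, (fib_step k).2]; ring
    · intro k
      simp only [(fib_step (k+1)).1, (fib_step (k+1)).2, (fib_step k).1, (fib_step k).2]; ring
    · simp only [hE, hO]
      push_cast
      linear_combination hc
    · simp only [hE]
    · simp only [show m + 4 = m + 3 + 1 from rfl, hS.1, hS.2, hE, hO]
      simp only [zero_add, mul_one, Nat.reduceAdd, Nat.fib_two, hF3]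
      push_cast
      linear_combination 4 * hc
    · simp only [show m + 4 = m + 3 + 1 from rfl, hS.1, hE, hO]
      linear_combination hc
    · linear_combination -hc
  · intro ho
    rw [ho.neg_one_pow] at hc
    have hl : lucas (m+3) ≠ 0 := by omega
    refine jac_general m _ _ hl hl (fun k => Nat.fib (2*k))
      (fun k => Nat.fib (2*k+1)) ?_ ?_ (by simp) (by simp) (by simp)
      (Nat.fib (m+3+1)) (Nat.fib (m+3))
      (2 * Nat.fib (m+3+1) + Nat.fib (m+3)) (Nat.fib (m+3+1) + Nat.fib (m+3)) ?_ ?_ ?_ ?_ ?_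
    · intro k
      simp only [(fib_step (k+1)).1, (fib_step k).1, (fib_step k).2]; ring
    · intro k
      simp only [(fib_step (k+1)).2, (fib_step k).1, (fib_step k).2]; ring
    · simp only [hO, hL]
      linear_combination -hc
    · simp only [hE, hL]; ring
    · simp only [show m + 4 = m + 3 + 1 from rfl, hS.2, hE, hO, hL]
      simp only [zero_add, mul_one, Nat.reduceAdd, Nat.fib_two, hF3]
      push_cast
      linear_combination -2 * hc
    · simp only [show m + 4 = m + 3 + 1 from rfl, hS.1, hE, hO, hL]
      linear_combination -hc
    · linear_combination hc
end
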